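/- Let (Ω,μ) be a probability space with measure-preserving ergodic ℝᴺ-dynamical system T, Φ ∈ Δ₂ a Young function with conjugate Φ̃ ∈ Δ₂. Suppose v ∈ L^Φ(Ω)ᴺ satisfies ∫_Ω v·g dμ = 0 for every g ∈ C^∞(Ω)ᴺ with div_{ω,Φ̃} g = 0. Then there exists u ∈ W¹_#L^Φ(Ω) such that v = D̄_ω u (the extended stochastic gradient). -/

import Mathlib

open MeasureTheory Filter Set Topology

noncomputable def luxNorm {α : Type*} [MeasurableSpace α] (Φ : ℝ → ℝ) (μ : Measure α)
    (f : α → ℝ) : ℝ :=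
  sInf {δ : ℝ | 0 < δ ∧ ∫⁻ a, ENNReal.ofReal (Φ (|f a| / δ)) ∂μ ≤ 1}

def MemLPhi {α : Type*} [MeasurableSpace α] (Φ : ℝ → ℝ) (μ : Measure α) (f : α → ℝ) : Prop :=
  Measurable f ∧ ∃ δ > 0, ∫⁻ a, ENNReal.ofReal (Φ (|f a| / δ)) ∂μ < ⊤

structure IsYoung (Φ : ℝ → ℝ) : Prop where
  continuousOn : ContinuousOn Φ (Ici 0)
  convexOn : ConvexOn ℝ (Ici 0) Φ
  map_zero : Φ 0 = 0
  pos : ∀ t > 0, 0 < Φ t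
  tendsto_zero : Tendsto (fun t => Φ t / t) (𝓝[>] (0:ℝ)) (𝓝 0)
  tendsto_top : Tendsto (fun t => Φ t / t) atTop atTop

structure IsYoungDensity (Φ φ : ℝ → ℝ) : Prop where
  mono : MonotoneOn φ (Ici 0)
  rightCont : ∀ t ≥ 0, ContinuousWithinAt φ (Ici t) t
  map_zero : φ 0 = 0
  pos : ∀ t > 0, 0 < φ t
  tendsto_top : Tendsto φ atTop atTop
  repr : ∀ t ≥ 0, Φ t = ∫ τ in (0:ℝ)..t, φ τ

noncomputable def youngConj (Φ : ℝ → ℝ) (t : ℝ) : ℝ :=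
  sSup {y : ℝ | ∃ s ≥ (0:ℝ), y = s * t - Φ s}

def Delta2 (Φ : ℝ → ℝ) : Prop := ∃ t₀ > 0, ∃ k > 2, ∀ t ≥ t₀, Φ (2 * t) ≤ k * Φ t

def DeltaPrime (Φ : ℝ → ℝ) : Prop :=
  ∃ β > 0, ∀ t ≥ (0:ℝ), ∀ s ≥ (0:ℝ), Φ (t * s) ≤ β * Φ t * Φ s

/-- A family of stochastic derivatives of all orders: `g l` is the iterated stochastic
derivative of `g []` in the directions listed in `l`, each `g l` is bounded measurable,
and `g (i :: l)` is the `i`-th stochastic derivative of `g l` (the difference quotients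
along the dynamical system converge essentially uniformly).  This encodes membership of
`g []` in the space `C^∞(Ω)` of the paper. -/
def StochSmoothFamily {N : ℕ} {Ω : Type*} [MeasurableSpace Ω] (μ : Measure Ω)
    (T : EuclideanSpace ℝ (Fin N) → Ω → Ω) (g : List (Fin N) → Ω → ℝ) : Prop :=
  (∀ l, Measurable (g l) ∧ ∃ C, ∀ ω, |g l ω| ≤ C) ∧
  ∀ l i, Tendsto (fun t : ℝ =>
      essSup (fun ω =>
        ENNReal.ofReal |(g l (T (t • EuclideanSpace.single i 1) ω) - g l ω) / t - g (i :: l) ω|) μ)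
    (𝓝[≠] (0:ℝ)) (𝓝 0)

section Orlicz

variable {Φ : ℝ → ℝ}

lemma IsYoung.le_div_mul (hY : IsYoung Φ) {s t : ℝ} (hs : 0 ≤ s) (hst : s ≤ t) (ht : 0 < t) :
    Φ s ≤ s / t * Φ t := by
  have h := hY.convexOn.2 (mem_Ici.2 ht.le) (mem_Ici.2 le_rfl) (by positivity : 0 ≤ s / t)
    (by rw [sub_nonneg, div_le_one ht]; exact hst : 0 ≤ 1 - s / t) (by ring)
  simp only [smul_eq_mul, mul_zero, add_zero, hY.map_zero] at h
  rwa [div_mul_cancel₀ _ ht.ne'] at h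

lemma IsYoung.nonneg (hY : IsYoung Φ) {t : ℝ} (ht : 0 ≤ t) : 0 ≤ Φ t := by
  rcases ht.eq_or_lt with rfl | h
  · exact hY.map_zero.ge
  · exact (hY.pos t h).le

lemma IsYoung.mono (hY : IsYoung Φ) {s t : ℝ} (hs : 0 ≤ s) (hst : s ≤ t) : Φ s ≤ Φ t := by
  rcases (hs.trans hst).eq_or_lt with h | ht
  · obtain rfl : s = t := by linarith
    exact le_rfl
  · refine (hY.le_div_mul hs hst ht).trans ?_
    exact mul_le_of_le_one_left (hY.nonneg ht.le) ((div_le_one ht).2 hst)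

lemma IsYoung.continuous_abs (hY : IsYoung Φ) : Continuous fun t : ℝ => Φ |t| :=
  hY.continuousOn.comp_continuous _root_.continuous_abs fun t => abs_nonneg t

lemma IsYoung.convexOn_abs (hY : IsYoung Φ) : ConvexOn ℝ univ fun t : ℝ => Φ |t| := by
  refine ⟨convex_univ, fun x _ y _ a b ha hb hab => ?_⟩
  refine (hY.mono (abs_nonneg _) ?_).trans
    (hY.convexOn.2 (abs_nonneg x) (abs_nonneg y) ha hb hab)
  simp only [smul_eq_mul]
  refine (abs_add_le _ _).trans_eq ?_
  rw [abs_mul, abs_mul, abs_of_nonneg ha, abs_of_nonneg hb]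

lemma IsYoung.measurable_ofReal {α : Type*} [MeasurableSpace α] (hY : IsYoung Φ) {f : α → ℝ}
    (hf : Measurable f) {δ : ℝ} (hδ : 0 < δ) :
    Measurable fun a => ENNReal.ofReal (Φ (|f a| / δ)) := by
  have h : Measurable fun a => ENNReal.ofReal (Φ |f a / δ|) :=
    ENNReal.measurable_ofReal.comp (hY.continuous_abs.measurable.comp (hf.div_const δ))
  simpa only [abs_div, abs_of_pos hδ] using h

/-- Jensen's inequality for Young functions, without any integrability assumption. -/
lemma IsYoung.ofReal_integral_le {Y : Type*} [MeasurableSpace Y] (hY : IsYoung Φ) (κ : Measure Y)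
    [IsProbabilityMeasure κ] {f : Y → ℝ} (hf : Measurable f) {δ : ℝ} (hδ : 0 < δ) :
    ENNReal.ofReal (Φ (|∫ y, f y ∂κ| / δ)) ≤ ∫⁻ y, ENNReal.ofReal (Φ (|f y| / δ)) ∂κ := by
  by_cases hfi : Integrable f κ
  swap
  · simp [integral_undef hfi, hY.map_zero]
  by_cases hfin : ∫⁻ y, ENNReal.ofReal (Φ (|f y| / δ)) ∂κ = ⊤
  · simp [hfin]
  have hnn : ∀ y, 0 ≤ Φ (|f y| / δ) := fun y => hY.nonneg (by positivity)
  have hm : Measurable fun y => Φ (|f y| / δ) := by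
    have h : Measurable fun a => Φ |f a / δ| := hY.continuous_abs.measurable.comp (hf.div_const δ)
    simpa only [abs_div, abs_of_pos hδ] using h
  have hint : Integrable (fun y => Φ (|f y| / δ)) κ := by
    refine ⟨hm.aestronglyMeasurable, ?_⟩
    rw [hasFiniteIntegral_iff_ofReal (.of_forall hnn)]
    exact lt_top_iff_ne_top.2 hfin
  rw [← ofReal_integral_eq_lintegral_ofReal hint (.of_forall hnn)]
  refine ENNReal.ofReal_le_ofReal ?_
  have h := hY.convexOn_abs.map_integral_le (μ := κ) (f := fun y => f y / δ)
    hY.continuous_abs.continuousOn isClosed_univ (by simp) (hfi.div_const δ)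
    (by simpa only [Function.comp_def, abs_div, abs_of_pos hδ] using hint)
  simpa only [integral_div, abs_div, abs_of_pos hδ] using h

variable {α : Type*} [MeasurableSpace α] {μ : Measure α}

/-- The Luxemburg norm of `f` is at most `δ`, expressed through the modular. -/
def LuxLE (Φ : ℝ → ℝ) (μ : Measure α) (f : α → ℝ) (δ : ℝ) : Prop :=
  ∫⁻ a, ENNReal.ofReal (Φ (|f a| / δ)) ∂μ ≤ 1

lemma LuxLE.luxNorm_le {f : α → ℝ} {δ : ℝ} (hδ : 0 < δ) (h : LuxLE Φ μ f δ) :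
    luxNorm Φ μ f ≤ δ :=
  csInf_le ⟨0, fun _ hx => hx.1.le⟩ ⟨hδ, h⟩

lemma LuxLE.congr {f g : α → ℝ} {δ : ℝ} (h : LuxLE Φ μ f δ) (hfg : f =ᵐ[μ] g) :
    LuxLE Φ μ g δ := by
  refine (lintegral_congr_ae ?_).trans_le h
  filter_upwards [hfg] with a ha
  rw [ha]

lemma LuxLE.neg {f : α → ℝ} {δ : ℝ} (h : LuxLE Φ μ f δ) : LuxLE Φ μ (fun a => -f a) δ := by
  simpa only [LuxLE, abs_neg] using h

lemma LuxLE.add (hY : IsYoung Φ) {f g : α → ℝ} (hf : Measurable f) (hg : Measurable g)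
    {a b : ℝ} (ha : 0 < a) (hb : 0 < b) (hfa : LuxLE Φ μ f a) (hgb : LuxLE Φ μ g b) :
    LuxLE Φ μ (fun x => f x + g x) (a + b) := by
  have hab : 0 < a + b := by positivity
  have key : ∀ x, ENNReal.ofReal (Φ (|f x + g x| / (a + b))) ≤
      ENNReal.ofReal (a / (a + b)) * ENNReal.ofReal (Φ (|f x| / a)) +
      ENNReal.ofReal (b / (a + b)) * ENNReal.ofReal (Φ (|g x| / b)) := by
    intro x
    have h1 : 0 ≤ Φ (|f x| / a) := hY.nonneg (by positivity)
    have h2 : 0 ≤ Φ (|g x| / b) := hY.nonneg (by positivity)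
    rw [← ENNReal.ofReal_mul (by positivity), ← ENNReal.ofReal_mul (by positivity),
      ← ENNReal.ofReal_add (by positivity) (by positivity)]
    refine ENNReal.ofReal_le_ofReal ?_
    have h := hY.convexOn.2 (mem_Ici.2 (by positivity : 0 ≤ |f x| / a))
      (mem_Ici.2 (by positivity : 0 ≤ |g x| / b)) (by positivity : 0 ≤ a / (a + b))
      (by positivity : 0 ≤ b / (a + b)) (by field_simp)
    refine (hY.mono (by positivity) ?_).trans h
    have : a / (a + b) * (|f x| / a) + b / (a + b) * (|g x| / b) = (|f x| + |g x|) / (a + b) := by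
      field_simp
    rw [smul_eq_mul, smul_eq_mul, this]
    gcongr
    exact abs_add_le _ _
  refine (lintegral_mono key).trans ?_
  rw [lintegral_add_left ((hY.measurable_ofReal hf ha).const_mul _),
    lintegral_const_mul _ (hY.measurable_ofReal hf ha),
    lintegral_const_mul _ (hY.measurable_ofReal hg hb)]
  calc _ ≤ ENNReal.ofReal (a / (a + b)) * 1 + ENNReal.ofReal (b / (a + b)) * 1 := by
        gcongr
        · exact hfa
        · exact hgb
    _ = 1 := by
        rw [mul_one, mul_one, ← ENNReal.ofReal_add (by positivity) (by positivity), ← add_div,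
          div_self hab.ne', ENNReal.ofReal_one]

lemma LuxLE.sum_smul (hY : IsYoung Φ) {ι : Type*} [Fintype ι] {w : ι → ℝ} (hw : ∀ k, 0 ≤ w k)
    (hw1 : ∑ k, w k = 1) {f : ι → α → ℝ} (hf : ∀ k, Measurable (f k)) {δ : ℝ} (hδ : 0 < δ)
    (h : ∀ k, LuxLE Φ μ (f k) δ) : LuxLE Φ μ (fun x => ∑ k, w k * f k x) δ := by
  have key : ∀ x, ENNReal.ofReal (Φ (|∑ k, w k * f k x| / δ)) ≤
      ∑ k, ENNReal.ofReal (w k) * ENNReal.ofReal (Φ (|f k x| / δ)) := by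
    intro x
    have hn : ∀ k, 0 ≤ Φ (|f k x| / δ) := fun k => hY.nonneg (by positivity)
    simp_rw [← ENNReal.ofReal_mul (hw _)]
    rw [← ENNReal.ofReal_sum_of_nonneg fun k _ => mul_nonneg (hw k) (hn k)]
    refine ENNReal.ofReal_le_ofReal ?_
    have := hY.convexOn_abs.map_sum_le (t := Finset.univ) (w := w) (p := fun k => f k x / δ)
      (fun k _ => hw k) hw1 (by simp)
    simp only [smul_eq_mul, abs_div, abs_of_pos hδ] at this
    refine le_trans (le_of_eq ?_) this
    congr 1
    rw [← abs_of_pos hδ, ← abs_div, Finset.sum_div, abs_of_pos hδ]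
    simp only [mul_div_assoc]
  refine (lintegral_mono key).trans ?_
  rw [lintegral_finsetSum _ fun k _ => (hY.measurable_ofReal (hf k) hδ).const_mul _]
  calc _ ≤ ∑ k, ENNReal.ofReal (w k) * 1 := by
        refine Finset.sum_le_sum fun k _ => ?_
        rw [lintegral_const_mul _ (hY.measurable_ofReal (hf k) hδ)]
        gcongr
        exact h k
    _ = 1 := by
        simp only [mul_one]
        rw [← ENNReal.ofReal_sum_of_nonneg fun k _ => hw k, hw1, ENNReal.ofReal_one]

lemma LuxLE.integral_const [IsProbabilityMeasure μ] (hY : IsYoung Φ) {f : α → ℝ}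
    (hf : Measurable f) {δ : ℝ} (hδ : 0 < δ) (h : LuxLE Φ μ f δ) :
    LuxLE Φ μ (fun _ => ∫ a, f a ∂μ) δ := by
  have := (hY.ofReal_integral_le μ hf hδ).trans h
  simpa [LuxLE] using this

lemma LuxLE.of_bounded (hY : IsYoung Φ) {f : α → ℝ} (hf : Integrable f μ) {K δ : ℝ} (hK : 0 < K)
    (hδ : 0 < δ) (hb : ∀ᵐ a ∂μ, |f a| ≤ K) (hs : (∫ a, |f a| ∂μ) * (Φ (K / δ) / K) ≤ 1) :
    LuxLE Φ μ f δ := by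
  have hΦ : 0 ≤ Φ (K / δ) := hY.nonneg (by positivity)
  calc ∫⁻ a, ENNReal.ofReal (Φ (|f a| / δ)) ∂μ
      ≤ ∫⁻ a, ENNReal.ofReal (|f a| * (Φ (K / δ) / K)) ∂μ := by
        refine lintegral_mono_ae ?_
        filter_upwards [hb] with a ha
        refine ENNReal.ofReal_le_ofReal ?_
        refine (hY.le_div_mul (t := K / δ) (by positivity) (by gcongr) (by positivity)).trans_eq ?_
        field_simp
    _ = ENNReal.ofReal ((∫ a, |f a| ∂μ) * (Φ (K / δ) / K)) := by
        rw [← ofReal_integral_eq_lintegral_ofReal (hf.abs.mul_const _)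
          (.of_forall fun a => by positivity), integral_mul_const]
    _ ≤ 1 := ENNReal.ofReal_le_one.2 hs

/-- Measurable functions all of whose dilates have finite modular. -/
def OrliczHeart (Φ : ℝ → ℝ) (μ : Measure α) (f : α → ℝ) : Prop :=
  Measurable f ∧ ∀ δ > 0, ∫⁻ a, ENNReal.ofReal (Φ (|f a| / δ)) ∂μ < ⊤

lemma MemLPhi.orliczHeart [IsFiniteMeasure μ] (hY : IsYoung Φ) (hΔ : Delta2 Φ) {f : α → ℝ}
    (hf : MemLPhi Φ μ f) : OrliczHeart Φ μ f := by
  obtain ⟨hm, δ₀, hδ₀, hfin⟩ := hf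
  obtain ⟨t₀, ht₀, k, hk, hd⟩ := hΔ
  have step : ∀ t ≥ 0, Φ (2 * t) ≤ k * Φ t + Φ (2 * t₀) := by
    intro t ht
    rcases le_total t₀ t with h | h
    · exact (hd t h).trans (le_add_of_nonneg_right (hY.nonneg (by positivity)))
    · refine (hY.mono (by positivity) (by gcongr : 2 * t ≤ 2 * t₀)).trans ?_
      exact le_add_of_nonneg_left (mul_nonneg (by linarith) (hY.nonneg ht))
  have dyadic : ∀ n : ℕ, ∫⁻ a, ENNReal.ofReal (Φ (2 ^ n * (|f a| / δ₀))) ∂μ < ⊤ := by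
    intro n
    induction n with
    | zero => simpa using hfin
    | succ n ih =>
      calc _ ≤ ∫⁻ a, (ENNReal.ofReal k * ENNReal.ofReal (Φ (2 ^ n * (|f a| / δ₀))) +
            ENNReal.ofReal (Φ (2 * t₀))) ∂μ := by
            refine lintegral_mono fun a => ?_
            have h0 : 0 ≤ Φ (2 * t₀) := hY.nonneg (by positivity)
            have h1 : 0 ≤ Φ (2 ^ n * (|f a| / δ₀)) := hY.nonneg (by positivity)
            rw [← ENNReal.ofReal_mul (by linarith), ← ENNReal.ofReal_add
              (mul_nonneg (by linarith) h1) h0]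
            refine ENNReal.ofReal_le_ofReal ?_
            rw [pow_succ', mul_assoc]
            exact step _ (by positivity)
        _ < ⊤ := by
            rw [lintegral_add_right _ measurable_const, lintegral_const_mul' _ _ (by simp)]
            refine ENNReal.add_lt_top.2 ⟨ENNReal.mul_lt_top (by simp) ih, ?_⟩
            rw [lintegral_const]
            exact ENNReal.mul_lt_top (by simp) (measure_lt_top _ _)
  refine ⟨hm, fun δ hδ => ?_⟩
  obtain ⟨n, hn⟩ := pow_unbounded_of_one_lt (δ₀ / δ) (one_lt_two (α := ℝ))
  refine (lintegral_mono fun a => ENNReal.ofReal_le_ofReal (hY.mono (by positivity) ?_)).trans_lt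
    (dyadic n)
  calc |f a| / δ = δ₀ / δ * (|f a| / δ₀) := by field_simp
    _ ≤ _ := by gcongr

lemma OrliczHeart.integrable [IsFiniteMeasure μ] (hY : IsYoung Φ) {f : α → ℝ}
    (hf : OrliczHeart Φ μ f) : Integrable f μ := by
  obtain ⟨t₁, h₁⟩ := eventually_atTop.1 (hY.tendsto_top.eventually_ge_atTop 1)
  have hle : ∀ t ≥ 0, t ≤ max t₁ 1 + Φ t := by
    intro t ht
    have hΦ := hY.nonneg ht
    rcases le_total t (max t₁ 1) with h | h
    · linarith
    · have ht1 : (1 : ℝ) ≤ t := (le_max_right _ _).trans h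
      have := h₁ t ((le_max_left _ _).trans h)
      rw [le_div_iff₀ (by linarith), one_mul] at this
      have : (1 : ℝ) ≤ max t₁ 1 := le_max_right _ _
      linarith
  refine ⟨hf.1.aestronglyMeasurable, ?_⟩
  rw [hasFiniteIntegral_iff_norm]
  calc ∫⁻ a, ENNReal.ofReal ‖f a‖ ∂μ
      ≤ ∫⁻ a, (ENNReal.ofReal (max t₁ 1) + ENNReal.ofReal (Φ (|f a| / 1))) ∂μ := by
        refine lintegral_mono fun a => ?_
        rw [← ENNReal.ofReal_add (by positivity) (hY.nonneg (by positivity)), div_one]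
        exact ENNReal.ofReal_le_ofReal (hle _ (abs_nonneg _))
    _ < ⊤ := by
        rw [lintegral_add_left measurable_const, lintegral_const]
        exact ENNReal.add_lt_top.2 ⟨ENNReal.mul_lt_top (by simp) (measure_lt_top _ _),
          hf.2 1 one_pos⟩

lemma OrliczHeart.congr {f g : α → ℝ} (hf : OrliczHeart Φ μ f) (hg : Measurable g)
    (h : f =ᵐ[μ] g) : OrliczHeart Φ μ g := by
  refine ⟨hg, fun δ hδ => (lintegral_congr_ae ?_).trans_lt (hf.2 δ hδ)⟩
  filter_upwards [h] with a ha
  rw [ha]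

lemma OrliczHeart.add (hY : IsYoung Φ) {f g : α → ℝ} (hf : OrliczHeart Φ μ f)
    (hg : OrliczHeart Φ μ g) : OrliczHeart Φ μ (fun x => f x + g x) := by
  refine ⟨hf.1.add hg.1, fun δ hδ => ?_⟩
  have key : ∀ x, ENNReal.ofReal (Φ (|f x + g x| / δ)) ≤
      ENNReal.ofReal (Φ (|f x| / (δ / 2))) + ENNReal.ofReal (Φ (|g x| / (δ / 2))) := by
    intro x
    have h1 : 0 ≤ Φ (|f x| / (δ / 2)) := hY.nonneg (by positivity)
    have h2 : 0 ≤ Φ (|g x| / (δ / 2)) := hY.nonneg (by positivity)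
    rw [← ENNReal.ofReal_add h1 h2]
    refine ENNReal.ofReal_le_ofReal ?_
    have hsum : |f x + g x| ≤ |f x| + |g x| := abs_add_le _ _
    rcases le_total |f x| |g x| with h | h
    · refine (hY.mono (by positivity) ?_).trans (le_add_of_nonneg_left h1)
      rw [div_div_eq_mul_div]
      gcongr
      linarith
    · refine (hY.mono (by positivity) ?_).trans (le_add_of_nonneg_right h2)
      rw [div_div_eq_mul_div]
      gcongr
      linarith
  refine (lintegral_mono key).trans_lt ?_
  rw [lintegral_add_left (hY.measurable_ofReal hf.1 (by positivity))]
  exact ENNReal.add_lt_top.2 ⟨hf.2 _ (by positivity), hg.2 _ (by positivity)⟩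

lemma OrliczHeart.const_mul {f : α → ℝ} (hf : OrliczHeart Φ μ f) (hY : IsYoung Φ) (c : ℝ) :
    OrliczHeart Φ μ (fun x => c * f x) := by
  refine ⟨hf.1.const_mul c, fun δ hδ => ?_⟩
  refine (lintegral_mono fun x => ENNReal.ofReal_le_ofReal (hY.mono (by positivity) ?_)).trans_lt
    (hf.2 (δ / (|c| + 1)) (by positivity))
  rw [div_div_eq_mul_div, abs_mul]
  refine div_le_div_of_nonneg_right ?_ hδ.le
  nlinarith [abs_nonneg (f x), abs_nonneg c]

lemma OrliczHeart.finsetSum [IsFiniteMeasure μ] (hY : IsYoung Φ) {ι : Type*} (s : Finset ι)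
    {f : ι → α → ℝ} (hf : ∀ k, OrliczHeart Φ μ (f k)) :
    OrliczHeart Φ μ (fun x => ∑ k ∈ s, f k x) := by
  classical
  induction s using Finset.induction_on with
  | empty => simp [OrliczHeart, hY.map_zero]
  | insert a s ha ih => simpa only [Finset.sum_insert ha] using (hf a).add hY ih

lemma OrliczHeart.comp {f : α → ℝ} (hf : OrliczHeart Φ μ f) (hY : IsYoung Φ) {τ : α → α}
    (hτ : MeasurePreserving τ μ μ) : OrliczHeart Φ μ (fun x => f (τ x)) := by
  refine ⟨hf.1.comp hτ.measurable, fun δ hδ => ?_⟩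
  rw [hτ.lintegral_comp (hY.measurable_ofReal hf.1 hδ)]
  exact hf.2 δ hδ

lemma LuxLE.comp {f : α → ℝ} {δ : ℝ} (h : LuxLE Φ μ f δ) (hY : IsYoung Φ) (hf : Measurable f)
    (hδ : 0 < δ) {τ : α → α} (hτ : MeasurePreserving τ μ μ) :
    LuxLE Φ μ (fun x => f (τ x)) δ := by
  rw [LuxLE, hτ.lintegral_comp (hY.measurable_ofReal hf hδ)]
  exact h

/-- Dominated convergence in the Luxemburg norm. -/
lemma OrliczHeart.eventually_luxLE (hY : IsYoung Φ) {g : α → ℝ} (hg : OrliczHeart Φ μ g)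
    {F : ℕ → α → ℝ} (hF : ∀ n, Measurable (F n)) (hb : ∀ n, ∀ᵐ a ∂μ, |F n a| ≤ |g a|)
    (hlim : ∀ᵐ a ∂μ, Tendsto (fun n => F n a) atTop (𝓝 0)) {δ : ℝ} (hδ : 0 < δ) :
    ∀ᶠ n in atTop, LuxLE Φ μ (F n) δ := by
  have h := tendsto_lintegral_of_dominated_convergence (μ := μ)
    (F := fun n a => ENNReal.ofReal (Φ (|F n a| / δ))) (f := fun _ => 0)
    (fun a => ENNReal.ofReal (Φ (|g a| / δ))) (fun n => hY.measurable_ofReal (hF n) hδ)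
    (fun n => ?_) (hg.2 δ hδ).ne ?_
  · rw [lintegral_zero] at h
    exact (h.eventually (gt_mem_nhds one_pos)).mono fun n hn => le_of_lt hn
  · filter_upwards [hb n] with a ha
    exact ENNReal.ofReal_le_ofReal (hY.mono (by positivity) (by gcongr))
  · filter_upwards [hlim] with a ha
    have := (hY.continuous_abs.tendsto 0).comp (ha.div_const δ |>.trans (by simp))
    have := (ENNReal.continuous_ofReal.tendsto _).comp this
    simpa [Function.comp_def, abs_div, abs_of_pos hδ, hY.map_zero] using this

/-- An element of the Orlicz heart is the sum of a bounded function and one of small norm. -/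
lemma OrliczHeart.exists_bounded_add (hY : IsYoung Φ) {f : α → ℝ} (hf : OrliczHeart Φ μ f)
    {δ : ℝ} (hδ : 0 < δ) : ∃ b r : α → ℝ, Measurable b ∧ OrliczHeart Φ μ r ∧
      (∃ C, ∀ a, |b a| ≤ C) ∧ LuxLE Φ μ r δ ∧ ∀ a, f a = b a + r a := by
  have hms : ∀ n : ℕ, MeasurableSet {a | (n : ℝ) < |f a|} := fun n =>
    measurableSet_lt measurable_const hf.1.abs
  have hle : ∀ n : ℕ, ∀ a, |indicator {a | (n : ℝ) < |f a|} f a| ≤ |f a| := fun n a => by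
    simpa only [Real.norm_eq_abs] using norm_indicator_le_norm_self (s := {a | (n : ℝ) < |f a|}) f a
  obtain ⟨n, hn⟩ := (hf.eventually_luxLE hY (F := fun n : ℕ => indicator {a | (n : ℝ) < |f a|} f)
    (fun n => hf.1.indicator (hms n)) (fun n => .of_forall (hle n))
    (.of_forall fun a => by
      refine tendsto_const_nhds.congr' ?_
      obtain ⟨m, hm⟩ := exists_nat_ge |f a|
      filter_upwards [eventually_ge_atTop m] with n hn
      rw [indicator_of_notMem]
      simp only [mem_ofPred_eq, not_lt]
      exact hm.trans (by exact_mod_cast hn)) hδ).exists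
  refine ⟨indicator {a | (n : ℝ) < |f a|}ᶜ f, indicator {a | (n : ℝ) < |f a|} f,
    hf.1.indicator (hms n).compl, ⟨hf.1.indicator (hms n), fun δ hδ => ?_⟩, ⟨n, fun a => ?_⟩, hn,
    fun a => ?_⟩
  · exact (lintegral_mono fun a => ENNReal.ofReal_le_ofReal (hY.mono (by positivity)
      (div_le_div_of_nonneg_right (hle n a) hδ.le))).trans_lt (hf.2 δ hδ)
  · by_cases h : (n : ℝ) < |f a|
    · simp [indicator, h]
    · simpa [indicator, h] using not_lt.1 h
  · rw [add_comm]
    exact (congrFun (indicator_self_add_compl _ f) a).symm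

end Orlicz

section MeanErgodic

/-- A version of the mean ergodic theorem: if `f` is orthogonal to the vectors invariant under an
isometric group action, then `0` is a limit of convex combinations of translates of `f`. -/
lemma zero_mem_closure_convexHull_orbit {H : Type*} [NormedAddCommGroup H] [InnerProductSpace ℝ H]
    [CompleteSpace H] {X : Type*} [AddCommGroup X] (U : X → H →ₗᵢ[ℝ] H)
    (hadd : ∀ x y f, U (x + y) f = U x (U y f)) (f : H)
    (horth : ∀ p, (∀ x, U x p = p) → inner ℝ p f = 0) :
    (0 : H) ∈ closure (convexHull ℝ (range fun x => U x f)) := by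
  set K := closure (convexHull ℝ (range fun x => U x f)) with hK
  have hconv : Convex ℝ K := (convex_convexHull ℝ _).closure
  have hne : K.Nonempty := ⟨U 0 f, subset_closure (subset_convexHull ℝ _ ⟨0, rfl⟩)⟩
  obtain ⟨p, hpK, hp⟩ := exists_norm_eq_iInf_of_complete_convex hne isClosed_closure.isComplete
    hconv 0
  have hmin := (norm_eq_iInf_iff_real_inner_le_zero hconv hpK).1 hp
  have hmap : ∀ x, ∀ q ∈ K, U x q ∈ K := by
    intro x q hq
    refine map_mem_closure (U x).continuous hq fun r hr => ?_
    have h : U x r ∈ (U x).toLinearMap '' convexHull ℝ (range fun x => U x f) := ⟨r, hr, rfl⟩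
    rw [LinearMap.image_convexHull] at h
    refine convexHull_mono ?_ h
    rintro _ ⟨_, ⟨y, rfl⟩, rfl⟩
    exact ⟨x + y, hadd x y f⟩
  have hinv : ∀ x, U x p = p := by
    intro x
    have h1 := hmin _ (hmap x p hpK)
    have h2 : inner ℝ (U x p) (U x p) = inner ℝ p p := (U x).inner_map_map p p
    have h3 : inner ℝ (U x p - p) (U x p - p) ≤ 0 := by
      simp only [inner_sub_left, inner_sub_right, zero_sub, inner_neg_left] at h1 ⊢
      rw [real_inner_comm p (U x p)] at *
      linarith
    exact sub_eq_zero.1 (real_inner_self_nonpos.1 h3)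
  have hle : inner ℝ p p ≤ 0 := by
    have hclosed : IsClosed {q : H | inner ℝ p q = 0} :=
      isClosed_eq (by fun_prop) continuous_const
    have hsub : K ⊆ {q : H | inner ℝ p q = 0} := by
      refine closure_minimal (convexHull_min ?_ ?_) hclosed
      · rintro _ ⟨x, rfl⟩
        show inner ℝ p (U x f) = 0
        rw [← hinv x, (U x).inner_map_map]
        exact horth p hinv
      · intro a ha b hb s t _ _ _
        simp only [mem_ofPred_eq] at ha hb ⊢
        rw [inner_add_right, inner_smul_right, inner_smul_right, ha, hb]
        simp
    exact (hsub hpK).le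
  obtain rfl : p = 0 := real_inner_self_nonpos.1 hle
  exact hpK

/-- A jointly measurable measure-preserving action. -/
structure IsFlow {E Ω : Type*} [AddCommGroup E] [MeasurableSpace E] [MeasurableSpace Ω]
    (μ : Measure Ω) (T : E → Ω → Ω) : Prop where
  zero : ∀ ω, T 0 ω = ω
  add : ∀ x y ω, T (x + y) ω = T x (T y ω)
  mp : ∀ x, MeasurePreserving (T x) μ μ
  meas : Measurable fun p : E × Ω => T p.1 p.2

/-- Finitely many bounded mean-zero functions are simultaneously made small in `L¹` by a common
convex combination of translations along an ergodic flow. -/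
lemma IsFlow.exists_convex_average_lt {X Ω : Type*} [AddCommGroup X] [MeasurableSpace X]
    [MeasurableSpace Ω] {μ : Measure Ω} [IsProbabilityMeasure μ] {T : X → Ω → Ω}
    (hT : IsFlow μ T)
    (herg : ∀ h : Ω → ℝ, Measurable h → (∀ x, ∀ᵐ ω ∂μ, h (T x ω) = h ω) →
      ∃ c : ℝ, ∀ᵐ ω ∂μ, h ω = c)
    {N : ℕ} (f : Fin N → Ω → ℝ) (hf : ∀ i, Measurable (f i)) (hb : ∀ i, ∃ C, ∀ ω, |f i ω| ≤ C)
    (h0 : ∀ i, ∫ ω, f i ω ∂μ = 0) {ε : ℝ} (hε : 0 < ε) :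
    ∃ (ι : Type) (_ : Fintype ι) (w : ι → ℝ) (z : ι → X), (∀ k, 0 ≤ w k) ∧ ∑ k, w k = 1 ∧
      ∀ i, ∫ ω, |∑ k, w k * f i (T (z k) ω)| ∂μ < ε := by
  have hbd : ∀ i (p : ENNReal), MemLp (f i) p μ := fun i p => by
    obtain ⟨C, hC⟩ := hb i
    exact MemLp.of_bound (hf i).aestronglyMeasurable C (.of_forall hC)
  set Fv : Ω → EuclideanSpace ℝ (Fin N) := fun ω => WithLp.toLp 2 fun i => f i ω with hFv
  have hFm : MemLp Fv 2 μ := by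
    refine MemLp.of_eval_piLp fun i => ?_
    exact hbd i 2
  set F := hFm.toLp Fv with hF
  have hFae : ∀ᵐ ω ∂μ, F ω = Fv ω := hFm.coeFn_toLp
  set U : X → Lp (EuclideanSpace ℝ (Fin N)) 2 μ →ₗᵢ[ℝ] Lp (EuclideanSpace ℝ (Fin N)) 2 μ :=
    fun x => Lp.compMeasurePreservingₗᵢ ℝ (T x) (hT.mp x) with hU
  have hUae : ∀ x (p : Lp (EuclideanSpace ℝ (Fin N)) 2 μ), ∀ᵐ ω ∂μ, U x p ω = p (T x ω) :=
    fun x p => Lp.coeFn_compMeasurePreserving p (hT.mp x)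
  have hmem := zero_mem_closure_convexHull_orbit U ?_ F ?_
  · obtain ⟨G, hG, hGε⟩ := Metric.mem_closure_iff.1 hmem ε hε
    rw [dist_zero_left] at hGε
    obtain ⟨ι, hι, w, z, hw, hw1, hz, rfl⟩ := mem_convexHull_iff_exists_fintype.1 hG
    choose x hx using hz
    refine ⟨ι, hι, w, x, hw, hw1, fun i => lt_of_le_of_lt ?_ hGε⟩
    set G := ∑ k, w k • z k with hGdef
    have hGae : ∀ᵐ ω ∂μ, G ω i = ∑ k, w k * f i (T (x k) ω) := by
      have h1 : ∀ᵐ ω ∂μ, G ω = ∑ k, (w k • z k : Lp (EuclideanSpace ℝ (Fin N)) 2 μ) ω :=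
        Lp.coeFn_fun_finsetSum Finset.univ fun k => w k • z k
      have h2 : ∀ᵐ ω ∂μ, ∀ k, (w k • z k : Lp (EuclideanSpace ℝ (Fin N)) 2 μ) ω = w k • z k ω :=
        ae_all_iff.2 fun k => Lp.coeFn_smul _ _
      have h3 : ∀ᵐ ω ∂μ, ∀ k, z k ω = F (T (x k) ω) :=
        ae_all_iff.2 fun k => by
          filter_upwards [hUae (x k) F] with ω hω
          rw [← hω, ← hx k]
      have h4 : ∀ᵐ ω ∂μ, ∀ k, F (T (x k) ω) = Fv (T (x k) ω) :=
        ae_all_iff.2 fun k => (hT.mp (x k)).quasiMeasurePreserving.ae hFae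
      filter_upwards [h1, h2, h3, h4] with ω h1 h2 h3 h4
      rw [h1]
      simp only [h2, h3, h4, hFv, WithLp.ofLp_sum, WithLp.ofLp_smul, Finset.sum_apply,
        Pi.smul_apply, smul_eq_mul]
    have hGm := Lp.memLp G
    calc ∫ ω, |∑ k, w k * f i (T (x k) ω)| ∂μ = ∫ ω, |G ω i| ∂μ := by
          refine integral_congr_ae ?_
          filter_upwards [hGae] with ω hω
          rw [hω]
      _ ≤ ∫ ω, ‖G ω‖ ∂μ := by
          have hGi : Integrable G μ := hGm.integrable (by norm_num)
          have hGi' : Integrable (fun ω => G ω i) μ :=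
            (hGm.eval_piLp i).integrable (by norm_num)
          refine integral_mono hGi'.abs hGi.norm fun ω => ?_
          exact PiLp.norm_apply_le (G ω) i
      _ = (eLpNorm G 1 μ).toReal := by
          rw [eLpNorm_one_eq_lintegral_enorm, integral_norm_eq_lintegral_enorm hGm.1]
      _ ≤ (eLpNorm G 2 μ).toReal :=
          ENNReal.toReal_mono hGm.2.ne (eLpNorm_le_eLpNorm_of_exponent_le (by norm_num) hGm.1)
      _ = ‖G‖ := (Lp.norm_def G).symm
  · intro x y p
    refine Lp.ext ?_
    have h := (hT.mp x).quasiMeasurePreserving.ae (hUae y p)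
    filter_upwards [hUae (x + y) p, hUae x (U y p), h] with ω h1 h2 h3
    rw [h1, h2, h3, add_comm, hT.add]
  · intro p hp
    have hpi : ∀ i, ∃ c : ℝ, ∀ᵐ ω ∂μ, p ω i = c := by
      intro i
      refine herg (fun ω => p ω i) ?_ fun x => ?_
      · exact (by fun_prop : Measurable fun v : EuclideanSpace ℝ (Fin N) => v i).comp
          (Lp.stronglyMeasurable p).measurable
      · filter_upwards [hUae x p] with ω hω
        rw [← hω, hp x]
    choose c hc using hpi
    rw [L2.inner_def]
    calc ∫ ω, inner ℝ (p ω) (F ω) ∂μ = ∫ ω, ∑ i, c i * f i ω ∂μ := by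
          refine integral_congr_ae ?_
          filter_upwards [ae_all_iff.2 hc, hFae] with ω h1 h2
          rw [h2, PiLp.inner_apply]
          refine Finset.sum_congr rfl fun i _ => ?_
          rw [h1 i, hFv]
          simp [mul_comm]
      _ = 0 := by
          rw [integral_finsetSum _ fun i _ => ((hbd i 1).integrable le_rfl).const_mul _]
          simp [integral_const_mul, h0]

end MeanErgodic

section OrbitConv

variable {N : ℕ} {Ω : Type*} [MeasurableSpace Ω] {μ : Measure Ω}
  {T : EuclideanSpace ℝ (Fin N) → Ω → Ω}

/-- Convolution of a kernel on `ℝᴺ` with a function on `Ω` along the orbits of `T`. -/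
noncomputable def orbitConv (T : EuclideanSpace ℝ (Fin N) → Ω → Ω)
    (k : EuclideanSpace ℝ (Fin N) → ℝ) (f : Ω → ℝ) (ω : Ω) : ℝ :=
  ∫ y, k y * f (T (-y) ω)

/-- Smooth compactly supported kernels. -/
structure IsTest (k : EuclideanSpace ℝ (Fin N) → ℝ) : Prop where
  contDiff : ContDiff ℝ ((⊤ : ℕ∞) : WithTop ℕ∞) k
  compact : HasCompactSupport k

/-- The `i`-th partial derivative. -/
noncomputable def pderiv (i : Fin N) (k : EuclideanSpace ℝ (Fin N) → ℝ) :
    EuclideanSpace ℝ (Fin N) → ℝ :=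
  fun y => fderiv ℝ k y (EuclideanSpace.single i 1)

/-- Iterated partial derivatives. -/
noncomputable def iterPderiv (k : EuclideanSpace ℝ (Fin N) → ℝ) :
    List (Fin N) → EuclideanSpace ℝ (Fin N) → ℝ
  | [] => k
  | i :: l => pderiv i (iterPderiv k l)

namespace IsTest

variable {k k' : EuclideanSpace ℝ (Fin N) → ℝ}

lemma continuous (hk : IsTest k) : Continuous k := hk.contDiff.continuous

lemma differentiable (hk : IsTest k) : Differentiable ℝ k := hk.contDiff.differentiable (by simp)

lemma integrable (hk : IsTest k) : Integrable k := hk.continuous.integrable_of_hasCompactSupport hk.compact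

lemma fderiv_apply (hk : IsTest k) (v : EuclideanSpace ℝ (Fin N)) :
    IsTest (fun y => fderiv ℝ k y v) :=
  ⟨(hk.contDiff.fderiv_right (m := ((⊤ : ℕ∞) : WithTop ℕ∞)) (by simp)).clm_apply contDiff_const,
    hk.compact.fderiv_apply ℝ v⟩

lemma pderiv (hk : IsTest k) (i : Fin N) : IsTest (pderiv i k) := hk.fderiv_apply _

lemma iterPderiv (hk : IsTest k) (l : List (Fin N)) : IsTest (iterPderiv k l) := by
  induction l with
  | nil => exact hk
  | cons i l ih => exact ih.pderiv i

lemma zero : IsTest (fun _ : EuclideanSpace ℝ (Fin N) => (0 : ℝ)) :=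
  ⟨contDiff_const, HasCompactSupport.zero⟩

lemma add (hk : IsTest k) (hk' : IsTest k') : IsTest (fun y => k y + k' y) :=
  ⟨hk.contDiff.add hk'.contDiff, hk.compact.add hk'.compact⟩

lemma const_mul (hk : IsTest k) (c : ℝ) : IsTest (fun y => c * k y) :=
  ⟨contDiff_const.mul hk.contDiff, hk.compact.mul_left⟩

lemma sub (hk : IsTest k) (hk' : IsTest k') : IsTest (fun y => k y - k' y) := by
  simpa [sub_eq_add_neg] using hk.add (hk'.const_mul (-1))

lemma sum {ι : Type*} (s : Finset ι) {k : ι → EuclideanSpace ℝ (Fin N) → ℝ}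
    (hk : ∀ j, IsTest (k j)) : IsTest (fun y => ∑ j ∈ s, k j y) := by
  classical
  induction s using Finset.induction_on with
  | empty => simpa using zero
  | insert a s ha ih => simpa only [Finset.sum_insert ha] using (hk a).add ih

lemma comp_neg (hk : IsTest k) : IsTest (fun y => k (-y)) :=
  ⟨hk.contDiff.comp contDiff_neg, hk.compact.comp_homeomorph (Homeomorph.neg _)⟩

lemma comp_sub (hk : IsTest k) (h : EuclideanSpace ℝ (Fin N)) : IsTest (fun y => k (y - h)) :=
  ⟨hk.contDiff.comp (contDiff_id.sub contDiff_const),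
    hk.compact.comp_homeomorph (Homeomorph.subRight h)⟩

end IsTest

lemma orbitConv_apply_flow (hT : IsFlow μ T) (k : EuclideanSpace ℝ (Fin N) → ℝ) (f : Ω → ℝ)
    (x : EuclideanSpace ℝ (Fin N)) (ω : Ω) :
    orbitConv T k f (T x ω) =
      convolution k (fun y => f (T y ω)) (ContinuousLinearMap.lsmul ℝ ℝ) volume x := by
  simp only [orbitConv, convolution_def, ContinuousLinearMap.lsmul_apply, smul_eq_mul,
    ← hT.add, neg_add_eq_sub]

lemma IsFlow.measurable_neg (hT : IsFlow μ T) :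
    Measurable fun p : EuclideanSpace ℝ (Fin N) × Ω => T (-p.1) p.2 :=
  hT.meas.comp (measurable_fst.neg.prodMk measurable_snd)

lemma measurable_orbitConv (hT : IsFlow μ T) {k : EuclideanSpace ℝ (Fin N) → ℝ} (hk : Measurable k)
    {f : Ω → ℝ} (hf : Measurable f) : Measurable (orbitConv T k f) := by
  have h : Measurable fun p : EuclideanSpace ℝ (Fin N) × Ω => k p.1 * f (T (-p.1) p.2) :=
    (hk.comp measurable_fst).mul (hf.comp hT.measurable_neg)
  exact (h.stronglyMeasurable.integral_prod_left').measurable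

lemma abs_orbitConv_le {Ω : Type*} {T : EuclideanSpace ℝ (Fin N) → Ω → Ω}
    {k : EuclideanSpace ℝ (Fin N) → ℝ} (hk : Integrable k) {b : Ω → ℝ} {C : ℝ}
    (hb : ∀ ω, |b ω| ≤ C) (ω : Ω) :
    |orbitConv T k b ω| ≤ (∫ y, |k y|) * C := by
  rw [← integral_mul_const]
  refine norm_integral_le_of_norm_le (f := fun y => k y * b (T (-y) ω)) (hk.abs.mul_const C)
    (.of_forall fun y => ?_)
  rw [norm_mul]
  exact mul_le_mul_of_nonneg_left (hb _) (norm_nonneg _)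

lemma hasFDerivAt_orbitConv (hT : IsFlow μ T) {k : EuclideanSpace ℝ (Fin N) → ℝ} (hk : IsTest k)
    {f : Ω → ℝ} {ω : Ω} (hf : LocallyIntegrable fun y => f (T y ω))
    (x : EuclideanSpace ℝ (Fin N)) :
    ∃ D : EuclideanSpace ℝ (Fin N) →L[ℝ] ℝ, HasFDerivAt (fun x => orbitConv T k f (T x ω)) D x ∧
      ∀ v, D v = orbitConv T (fun y => fderiv ℝ k y v) f (T x ω) := by
  have h := hk.compact.hasFDerivAt_convolution_left (ContinuousLinearMap.lsmul ℝ ℝ)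
    (hk.contDiff.of_le (by simp)) hf x
  refine ⟨_, h.congr_of_eventuallyEq (.of_forall fun x => orbitConv_apply_flow hT k f x ω),
    fun v => ?_⟩
  have hI := (hk.compact.fderiv ℝ).convolutionExists_left
    (ContinuousLinearMap.precompL (EuclideanSpace ℝ (Fin N)) (ContinuousLinearMap.lsmul ℝ ℝ))
    (hk.contDiff.continuous_fderiv (by simp)) hf x
  rw [orbitConv_apply_flow hT, convolution_def, convolution_def]
  exact ContinuousLinearMap.integral_apply hI v

lemma contDiff_orbitConv (hT : IsFlow μ T) {k : EuclideanSpace ℝ (Fin N) → ℝ} (hk : IsTest k)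
    {f : Ω → ℝ} {ω : Ω} (hf : LocallyIntegrable fun y => f (T y ω)) :
    ContDiff ℝ ((⊤ : ℕ∞) : WithTop ℕ∞) fun x => orbitConv T k f (T x ω) := by
  simp only [orbitConv_apply_flow hT]
  exact hk.compact.contDiff_convolution_left _ hk.contDiff hf

lemma locallyIntegrable_of_bounded (hT : IsFlow μ T) {b : Ω → ℝ} (hb : Measurable b) {C : ℝ}
    (hC : ∀ ω, |b ω| ≤ C) (ω : Ω) : LocallyIntegrable fun y => b (T y ω) :=
  (locallyIntegrable_const C).mono
    (hb.comp (hT.meas.comp (measurable_id.prodMk measurable_const))).aestronglyMeasurable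
    (.of_forall fun _ => (hC _).trans (le_abs_self C))

/-- A quantitative form of differentiability at `0` for functions with bounded second
derivative. -/
lemma abs_slope_sub_le {F F' F'' : ℝ → ℝ} (h1 : ∀ t, HasDerivAt F (F' t) t)
    (h2 : ∀ t, HasDerivAt F' (F'' t) t) {C : ℝ} (hC : ∀ t, |F'' t| ≤ C) {t : ℝ} (ht : t ≠ 0) :
    |(F t - F 0) / t - F' 0| ≤ C * |t| := by
  have hlip : ∀ s, |F' s - F' 0| ≤ C * |s| := fun s => by
    simpa using convex_univ.norm_image_sub_le_of_norm_hasDerivWithin_le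
      (fun x _ => (h2 x).hasDerivWithinAt) (fun x _ => hC x) (mem_univ (0 : ℝ)) (mem_univ s)
  have hG : ∀ s ∈ uIcc 0 t, |F' s - F' 0| ≤ C * |t| := fun s hs => by
    refine (hlip s).trans (mul_le_mul_of_nonneg_left ?_ ((abs_nonneg _).trans (hC 0)))
    simpa using abs_sub_left_of_mem_uIcc hs
  have h := (convex_uIcc 0 t).norm_image_sub_le_of_norm_hasDerivWithin_le
    (f := fun s => F s - F' 0 * s) (f' := fun s => F' s - F' 0) (C := C * |t|)
    (fun x _ => by
      have h := (h1 x).fun_sub ((hasDerivAt_id x).const_mul (F' 0))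
      simp only [id_eq, mul_one] at h
      exact h.hasDerivWithinAt)
    hG left_mem_uIcc right_mem_uIcc
  have he : (F t - F 0) / t - F' 0 = (F t - F' 0 * t - (F 0 - F' 0 * 0)) / t := by
    field_simp
    ring
  rw [he, abs_div, div_le_iff₀ (abs_pos.2 ht)]
  simpa using h

lemma stochSmoothFamily_orbitConv (hT : IsFlow μ T) {k : EuclideanSpace ℝ (Fin N) → ℝ}
    (hk : IsTest k) {b : Ω → ℝ} (hb : Measurable b) {C : ℝ} (hC : ∀ ω, |b ω| ≤ C) :
    StochSmoothFamily μ T fun l => orbitConv T (iterPderiv k l) b := by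
  refine ⟨fun l => ⟨measurable_orbitConv hT (hk.iterPderiv l).continuous.measurable hb, _,
    abs_orbitConv_le (hk.iterPderiv l).integrable hC⟩, fun l i => ?_⟩
  have hder : ∀ (m : List (Fin N)) (ω : Ω) (t : ℝ), HasDerivAt
      (fun t : ℝ => orbitConv T (iterPderiv k m) b (T (t • EuclideanSpace.single i 1) ω))
      (orbitConv T (iterPderiv k (i :: m)) b (T (t • EuclideanSpace.single i 1) ω)) t := by
    intro m ω t
    obtain ⟨D, hD, hDv⟩ := hasFDerivAt_orbitConv hT (hk.iterPderiv m)
      (locallyIntegrable_of_bounded hT hb hC ω) (t • EuclideanSpace.single i 1)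
    have hline : HasDerivAt (fun t : ℝ => t • EuclideanSpace.single i (1 : ℝ))
        (EuclideanSpace.single i 1) t := by
      simpa using (hasDerivAt_id t).smul_const (EuclideanSpace.single i (1 : ℝ))
    have := hD.comp_hasDerivAt t hline
    rw [hDv] at this
    exact this
  set M := (∫ y, |iterPderiv k (i :: i :: l) y|) * C with hM
  have hbound : ∀ t : ℝ, t ≠ 0 → ∀ ω,
      |(orbitConv T (iterPderiv k l) b (T (t • EuclideanSpace.single i 1) ω) -
        orbitConv T (iterPderiv k l) b ω) / t - orbitConv T (iterPderiv k (i :: l)) b ω|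
        ≤ M * |t| := by
    intro t ht ω
    have := abs_slope_sub_le (hder l ω) (hder (i :: l) ω)
      (fun s => abs_orbitConv_le (hk.iterPderiv (i :: i :: l)).integrable hC
        (T (s • EuclideanSpace.single i 1) ω)) ht
    simpa only [zero_smul, hT.zero] using this
  refine tendsto_of_tendsto_of_tendsto_of_le_of_le' (h := fun t : ℝ => ENNReal.ofReal (M * |t|))
    tendsto_const_nhds ?_ (.of_forall fun _ => zero_le) ?_
  · have : Tendsto (fun t : ℝ => ENNReal.ofReal (M * |t|)) (𝓝 0) (𝓝 (ENNReal.ofReal (M * |0|))) :=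
      (ENNReal.continuous_ofReal.comp (by fun_prop : Continuous fun t : ℝ => M * |t|)).tendsto 0
    simpa using this.mono_left nhdsWithin_le_nhds
  · filter_upwards [self_mem_nhdsWithin] with t ht
    exact essSup_le_of_ae_le _ (.of_forall fun ω => ENNReal.ofReal_le_ofReal (hbound t ht ω))

lemma integrable_kernel_mul_flow (hT : IsFlow μ T) [SFinite μ]
    {k : EuclideanSpace ℝ (Fin N) → ℝ}
    (hk : Integrable k) (hkm : Measurable k) {f : Ω → ℝ} (hfm : Measurable f)
    (hf : Integrable f μ) :
    Integrable (fun p : EuclideanSpace ℝ (Fin N) × Ω => k p.1 * f (T p.1 p.2))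
      (volume.prod μ) := by
  have hm : Measurable fun p : EuclideanSpace ℝ (Fin N) × Ω => k p.1 * f (T p.1 p.2) :=
    (hkm.comp measurable_fst).mul (hfm.comp hT.meas)
  rw [integrable_prod_iff hm.aestronglyMeasurable]
  refine ⟨.of_forall fun y => ((hT.mp y).integrable_comp_of_integrable hf).const_mul (k y), ?_⟩
  have : (fun y => ∫ ω, ‖k y * f (T y ω)‖ ∂μ) = fun y => ‖k y‖ * ∫ ω, ‖f ω‖ ∂μ := by
    funext y
    simp_rw [norm_mul]
    rw [integral_const_mul]
    congr 1
    have h := (hT.mp y).map_eq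
    conv_rhs => rw [← h]
    rw [integral_map (hT.mp y).measurable.aemeasurable hfm.norm.aestronglyMeasurable]
  simp only [this]
  exact hk.norm.mul_const _

lemma ae_locallyIntegrable (hT : IsFlow μ T) [SFinite μ] {f : Ω → ℝ} (hfm : Measurable f)
    (hf : Integrable f μ) : ∀ᵐ ω ∂μ, LocallyIntegrable fun y => f (T y ω) := by
  have h : ∀ n : ℕ, ∀ᵐ ω ∂μ,
      IntegrableOn (fun y => f (T y ω)) (Metric.closedBall (0 : EuclideanSpace ℝ (Fin N)) n) := by
    intro n
    have hms : MeasurableSet (Metric.closedBall (0 : EuclideanSpace ℝ (Fin N)) n) :=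
      measurableSet_closedBall
    have := (integrable_kernel_mul_flow hT
      (k := indicator (Metric.closedBall (0 : EuclideanSpace ℝ (Fin N)) n) fun _ => 1)
      ((integrable_indicator_iff hms).2 (integrableOn_const (isCompact_closedBall _ _).measure_ne_top))
      (measurable_const.indicator hms) hfm hf).prod_left_ae
    filter_upwards [this] with ω hω
    rw [← integrable_indicator_iff hms]
    refine hω.congr (.of_forall fun y => ?_)
    by_cases hy : y ∈ Metric.closedBall (0 : EuclideanSpace ℝ (Fin N)) n <;> simp [indicator, hy]
  filter_upwards [ae_all_iff.2 h] with ω hω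
  rw [locallyIntegrable_iff]
  intro K hK
  obtain ⟨r, hr⟩ := hK.isBounded.subset_closedBall 0
  obtain ⟨n, hn⟩ := exists_nat_ge r
  exact (hω n).mono_set (hr.trans (Metric.closedBall_subset_closedBall hn))

lemma integrable_kernel_mul_flow_neg (hT : IsFlow μ T) [SFinite μ]
    {k : EuclideanSpace ℝ (Fin N) → ℝ} (hk : IsTest k) {f : Ω → ℝ} (hfm : Measurable f)
    (hf : Integrable f μ) :
    Integrable (fun p : EuclideanSpace ℝ (Fin N) × Ω => k p.1 * f (T (-p.1) p.2))
      (volume.prod μ) := by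
  have h := integrable_kernel_mul_flow hT hk.comp_neg.integrable hk.comp_neg.continuous.measurable
    hfm hf
  have hn : MeasurePreserving (Prod.map Neg.neg id)
      ((volume : Measure (EuclideanSpace ℝ (Fin N))).prod μ) (volume.prod μ) :=
    (Measure.measurePreserving_neg volume).prod (.id μ)
  simpa [Function.comp_def] using hn.integrable_comp_of_integrable h

lemma integrable_orbitConv (hT : IsFlow μ T) [SFinite μ] {k : EuclideanSpace ℝ (Fin N) → ℝ}
    (hk : IsTest k) {f : Ω → ℝ} (hfm : Measurable f) (hf : Integrable f μ) :
    Integrable (orbitConv T k f) μ :=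
  (integrable_kernel_mul_flow_neg hT hk hfm hf).integral_prod_right

/-- Orbit convolution with the reflected kernel is the formal adjoint. -/
lemma integral_mul_orbitConv (hT : IsFlow μ T) [SFinite μ] {k : EuclideanSpace ℝ (Fin N) → ℝ}
    (hk : IsTest k) {f : Ω → ℝ} (hfm : Measurable f) (hf : Integrable f μ) {b : Ω → ℝ}
    (hb : Measurable b) {C : ℝ} (hC : ∀ ω, |b ω| ≤ C) :
    ∫ ω, f ω * orbitConv T k b ω ∂μ = ∫ ω, b ω * orbitConv T (fun y => k (-y)) f ω ∂μ := by
  have hI1 : Integrable (fun p : Ω × EuclideanSpace ℝ (Fin N) =>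
      f p.1 * (k p.2 * b (T (-p.2) p.1))) (μ.prod volume) := by
    have h := (hf.mul_prod hk.integrable).mul_bdd (g := fun p : Ω × EuclideanSpace ℝ (Fin N) => b (T (-p.2) p.1)) (c := C)
      (hb.comp (hT.measurable_neg.comp measurable_swap)).aestronglyMeasurable
      (.of_forall fun p => hC _)
    refine h.congr (.of_forall fun p => ?_)
    simp only [mul_assoc]
  have hI2 : Integrable (fun p : Ω × EuclideanSpace ℝ (Fin N) =>
      b p.1 * (k p.2 * f (T p.2 p.1))) (μ.prod volume) := by
    have h := (integrable_kernel_mul_flow hT hk.integrable hk.continuous.measurable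
      hfm hf).swap.bdd_mul (f := fun p : Ω × EuclideanSpace ℝ (Fin N) => b p.1) (c := C)
      (hb.comp measurable_fst).aestronglyMeasurable (.of_forall fun p => hC _)
    exact h
  have hinner : ∀ y, ∫ ω, f ω * (k y * b (T (-y) ω)) ∂μ = ∫ ω, b ω * (k y * f (T y ω)) ∂μ := by
    intro y
    have hm : Measurable fun ω => f ω * (k y * b (T (-y) ω)) :=
      hfm.mul ((hb.comp (hT.mp (-y)).measurable).const_mul _)
    conv_lhs => rw [← (hT.mp y).map_eq]
    rw [integral_map (hT.mp y).measurable.aemeasurable hm.aestronglyMeasurable]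
    refine integral_congr_ae (.of_forall fun ω => ?_)
    simp only [← hT.add, neg_add_cancel, hT.zero]
    ring
  calc ∫ ω, f ω * orbitConv T k b ω ∂μ = ∫ ω, (∫ y, f ω * (k y * b (T (-y) ω))) ∂μ := by
        simp only [orbitConv, integral_const_mul]
    _ = ∫ y, ∫ ω, f ω * (k y * b (T (-y) ω)) ∂μ := integral_integral_swap hI1
    _ = ∫ y, ∫ ω, b ω * (k y * f (T y ω)) ∂μ := by simp only [hinner]
    _ = ∫ ω, (∫ y, b ω * (k y * f (T y ω))) ∂μ := (integral_integral_swap hI2).symm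
    _ = ∫ ω, b ω * orbitConv T (fun y => k (-y)) f ω ∂μ := by
        simp only [orbitConv, integral_const_mul]
        refine integral_congr_ae (.of_forall fun ω => ?_)
        simp only
        rw [← integral_neg_eq_self]

end OrbitConv

section Potential

variable {N : ℕ} {Ω : Type*} [MeasurableSpace Ω] {μ : Measure Ω}
  {T : EuclideanSpace ℝ (Fin N) → Ω → Ω}

/-- `v` is orthogonal to all smooth divergence-free fields. -/
def OrthSolenoidal (μ : Measure Ω) (T : EuclideanSpace ℝ (Fin N) → Ω → Ω)
    (v : Fin N → Ω → ℝ) : Prop :=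
  ∀ Dg : Fin N → List (Fin N) → Ω → ℝ, (∀ i, StochSmoothFamily μ T (Dg i)) →
    (∀ᵐ ω ∂μ, ∑ i, Dg i [i] ω = 0) → ∫ ω, ∑ i, v i ω * Dg i [] ω ∂μ = 0

lemma pderiv_comp_neg (i : Fin N) (k : EuclideanSpace ℝ (Fin N) → ℝ)
    (y : EuclideanSpace ℝ (Fin N)) : pderiv i (fun y => k (-y)) y = -pderiv i k (-y) := by
  have := fderiv_comp_smul (𝕜 := ℝ) (f := k) (x := y) (-1 : ℝ)
  simp only [neg_smul, one_smul] at this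
  simp [pderiv, this]

/-- A field orthogonal to the smooth divergence-free fields is annihilated by convolution with
every divergence-free vector kernel. -/
lemma OrthSolenoidal.ae_sum_orbitConv_eq_zero [IsFiniteMeasure μ] {v : Fin N → Ω → ℝ}
    (h : OrthSolenoidal μ T v) (hT : IsFlow μ T) (hvm : ∀ i, Measurable (v i))
    (hvi : ∀ i, Integrable (v i) μ) {K : Fin N → EuclideanSpace ℝ (Fin N) → ℝ}
    (hK : ∀ a, IsTest (K a)) (hdiv : ∀ y, ∑ a, pderiv a (K a) y = 0) :
    ∀ᵐ ω ∂μ, ∑ a, orbitConv T (K a) (v a) ω = 0 := by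
  have hint : Integrable (fun ω => ∑ a, orbitConv T (K a) (v a) ω) μ :=
    integrable_finsetSum _ fun a _ => integrable_orbitConv hT (hK a) (hvm a) (hvi a)
  refine ae_eq_zero_of_forall_setIntegral_eq_of_sigmaFinite
    (fun s _ _ => hint.integrableOn) fun s hs _ => ?_
  set b : Ω → ℝ := indicator s fun _ => 1 with hb
  have hbm : Measurable b := measurable_const.indicator hs
  have hbC : ∀ ω, |b ω| ≤ 1 := fun ω => by
    by_cases hω : ω ∈ s <;> simp [hb, hω]
  have hz := h (fun a l => orbitConv T (iterPderiv (fun y => K a (-y)) l) b)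
    (fun a => stochSmoothFamily_orbitConv hT (hK a).comp_neg hbm hbC) (.of_forall fun ω => by
      have hi : ∀ a, Integrable
          (fun y => iterPderiv (fun y => K a (-y)) [a] y * b (T (-y) ω)) := fun a =>
        ((hK a).comp_neg.iterPderiv [a]).integrable.mul_bdd (c := 1)
          (hbm.comp (hT.meas.comp (measurable_neg.prodMk measurable_const))).aestronglyMeasurable
          (.of_forall fun y => hbC _)
      simp only [orbitConv]
      rw [← integral_finsetSum _ fun a _ => hi a]
      simp only [← Finset.sum_mul]
      refine integral_eq_zero_of_ae (.of_forall fun y => ?_)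
      simp only [iterPderiv, pderiv_comp_neg, Finset.sum_neg_distrib, hdiv, neg_zero, zero_mul,
        Pi.zero_apply])
  have hbdd : ∀ g : Ω → ℝ, Integrable g μ → Integrable (fun ω => b ω * g ω) μ :=
    fun g hg => hg.bdd_mul (c := 1) hbm.aestronglyMeasurable (.of_forall hbC)
  have hbd2 : ∀ a, Integrable
      (fun ω => v a ω * orbitConv T (iterPderiv (fun y => K a (-y)) []) b ω) μ := fun a =>
    (hvi a).mul_bdd (c := (∫ y, |K a (-y)|) * 1)
      (measurable_orbitConv hT (hK a).comp_neg.continuous.measurable hbm).aestronglyMeasurable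
      (.of_forall fun ω => abs_orbitConv_le (hK a).comp_neg.integrable hbC ω)
  rw [integral_finsetSum _ fun a _ => hbd2 a] at hz
  simp only [iterPderiv] at hz
  simp only [fun a => integral_mul_orbitConv hT (hK a).comp_neg (hvm a) (hvi a) hbm hbC,
    neg_neg] at hz
  rw [← integral_indicator hs, ← hz, ← integral_finsetSum]
  · refine integral_congr_ae (.of_forall fun ω => ?_)
    by_cases hω : ω ∈ s <;> simp [hb, hω]
  · exact fun a _ => hbdd _ (integrable_orbitConv hT (hK a) (hvm a) (hvi a))

lemma OrthSolenoidal.integral_eq_zero {v : Fin N → Ω → ℝ}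
    (h : OrthSolenoidal μ T v) (i : Fin N) : ∫ ω, v i ω ∂μ = 0 := by
  classical
  have := h (fun a l _ => if a = i ∧ l = [] then 1 else 0) (fun a => ⟨fun l => ⟨measurable_const, 1,
    fun ω => by simp only; split_ifs <;> simp⟩, fun l j => by
      simp only [sub_self, zero_div, reduceCtorEq, and_false, if_false, abs_zero,
        ENNReal.ofReal_zero]
      exact (tendsto_const_nhds (x := (0 : ENNReal))).congr fun _ => (le_antisymm
        (essSup_le_of_ae_le _ (.of_forall fun _ => le_rfl)) zero_le).symm⟩) (.of_forall fun ω => by simp)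
  simpa using this

/-- The difference of a test function and its translate is a directional derivative of a test
function. -/
lemma IsTest.exists_fderiv_eq_sub {ρ : EuclideanSpace ℝ (Fin N) → ℝ} (hρ : IsTest ρ)
    (h : EuclideanSpace ℝ (Fin N)) :
    ∃ κ, IsTest κ ∧ ∀ y, fderiv ℝ κ y h = ρ y - ρ (y - h) := by
  set ν : Measure (EuclideanSpace ℝ (Fin N)) :=
    (volume.restrict (Icc (0 : ℝ) 1)).map fun s => s • h with hν
  have : IsFiniteMeasure ν := by rw [hν]; infer_instance
  set κ := convolution (fun _ => (1 : ℝ)) ρ (ContinuousLinearMap.lsmul ℝ ℝ) ν with hκ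
  have hκ_eq : ∀ y, κ y = ∫ s in (0 : ℝ)..1, ρ (y - s • h) := fun y => by
    have hc : Continuous fun t => ρ (y - t) := hρ.continuous.comp (continuous_sub_left y)
    simp only [hκ, convolution_def, ContinuousLinearMap.lsmul_apply, smul_eq_mul, one_mul]
    rw [hν, integral_map (by fun_prop) hc.measurable.aestronglyMeasurable,
      intervalIntegral.integral_of_le zero_le_one, ← integral_Icc_eq_integral_Ioc]
  have hsmooth : ContDiff ℝ ((⊤ : ℕ∞) : WithTop ℕ∞) κ :=
    hρ.compact.contDiff_convolution_right _ (integrable_const _).locallyIntegrable hρ.contDiff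
  refine ⟨κ, ⟨hsmooth, ?_⟩, fun y => ?_⟩
  · refine HasCompactSupport.intro
      (K := (fun p : EuclideanSpace ℝ (Fin N) × ℝ => p.1 + p.2 • h) '' (tsupport ρ ×ˢ Icc 0 1))
      ((hρ.compact.isCompact.prod isCompact_Icc).image (by fun_prop)) fun y hy => ?_
    rw [hκ_eq]
    refine intervalIntegral.integral_zero_ae (.of_forall fun s hs => ?_)
    rw [uIoc_of_le zero_le_one] at hs
    by_contra hne
    exact hy ⟨(y - s • h, s), ⟨subset_tsupport _ hne, Ioc_subset_Icc_self hs⟩, by simp⟩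
  · set g : ℝ → ℝ := fun u => ρ (y - u • h) with hg
    have hgc : Continuous g := hρ.continuous.comp (by fun_prop)
    have hline : ∀ t : ℝ, κ (y + t • h) = (∫ u in (0 : ℝ)..(1 - t), g u) - ∫ u in (0 : ℝ)..(0 - t), g u := by
      intro t
      rw [hκ_eq, intervalIntegral.integral_interval_sub_left (hgc.intervalIntegrable _ _)
        (hgc.intervalIntegrable _ _), ← intervalIntegral.integral_comp_sub_right g t]
      refine intervalIntegral.integral_congr fun s _ => ?_
      simp only [hg]
      congr 1
      module
    have hG : ∀ c : ℝ, HasDerivAt (fun t => ∫ u in (0 : ℝ)..(c - t), g u) (-g c) 0 := by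
      intro c
      have h1 : HasDerivAt (fun t : ℝ => c - t) (-1) 0 := by
        simpa using (hasDerivAt_id (0 : ℝ)).const_sub c
      have h2 := (hgc.integral_hasStrictDerivAt 0 (c - 0)).hasDerivAt.comp (0 : ℝ) h1
      simpa [Function.comp_def] using h2
    have hd : HasDerivAt (fun t : ℝ => κ (y + t • h)) (-g 1 - -g 0) 0 := by
      simp only [hline]
      exact (hG 1).sub (hG 0)
    have h1 : HasDerivAt (fun t : ℝ => y + t • h) h 0 := by
      simpa using ((hasDerivAt_id (0 : ℝ)).smul_const h).const_add y
    have h2 := ((hsmooth.differentiable (by simp)) (y + (0 : ℝ) • h)).hasFDerivAt.comp_hasDerivAt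
      (0 : ℝ) h1
    have := h2.unique hd
    simp only [zero_smul, add_zero] at this
    rw [this]
    simp only [hg, one_smul, zero_smul, sub_zero]
    ring

end Potential

section Kernels

variable {N : ℕ} {Ω : Type*} [MeasurableSpace Ω] {μ : Measure Ω}
  {T : EuclideanSpace ℝ (Fin N) → Ω → Ω}

lemma pderiv_const_mul (i : Fin N) {k : EuclideanSpace ℝ (Fin N) → ℝ} (hk : IsTest k) (c : ℝ)
    (y : EuclideanSpace ℝ (Fin N)) : pderiv i (fun y => c * k y) y = c * pderiv i k y := by
  rw [pderiv, fderiv_const_mul (hk.differentiable y)]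
  rfl

lemma pderiv_sub (i : Fin N) {k k' : EuclideanSpace ℝ (Fin N) → ℝ} (hk : IsTest k)
    (hk' : IsTest k') (y : EuclideanSpace ℝ (Fin N)) :
    pderiv i (fun y => k y - k' y) y = pderiv i k y - pderiv i k' y := by
  rw [pderiv, fderiv_fun_sub (hk.differentiable y) (hk'.differentiable y)]
  rfl

lemma pderiv_sum (i : Fin N) {ι : Type*} (s : Finset ι) {k : ι → EuclideanSpace ℝ (Fin N) → ℝ}
    (hk : ∀ j, IsTest (k j)) (y : EuclideanSpace ℝ (Fin N)) :
    pderiv i (fun y => ∑ j ∈ s, k j y) y = ∑ j ∈ s, pderiv i (k j) y := by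
  rw [pderiv, fderiv_fun_sum fun j _ => (hk j).differentiable y]
  simp [pderiv]

lemma pderiv_comm (i j : Fin N) {k : EuclideanSpace ℝ (Fin N) → ℝ} (hk : IsTest k)
    (y : EuclideanSpace ℝ (Fin N)) : pderiv i (pderiv j k) y = pderiv j (pderiv i k) y := by
  have hd : DifferentiableAt ℝ (fderiv ℝ k) y :=
    (hk.contDiff.fderiv_right (m := ((⊤ : ℕ∞) : WithTop ℕ∞)) (by simp)).differentiable (by simp) y
  have hs := ((hk.contDiff.of_le (m := ((2 : ℕ∞) : WithTop ℕ∞)) (mod_cast le_top)).contDiffAt (x := y)).isSymmSndFDerivAt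
    (by simp)
  have h : ∀ a b, pderiv a (pderiv b k) y =
      fderiv ℝ (fderiv ℝ k) y (EuclideanSpace.single a 1) (EuclideanSpace.single b 1) := by
    intro a b
    unfold pderiv
    rw [fderiv_clm_apply hd (differentiableAt_const _)]
    simp
  rw [h, h]
  exact hs _ _

lemma sum_mul_pderiv (k : EuclideanSpace ℝ (Fin N) → ℝ) (y h : EuclideanSpace ℝ (Fin N)) :
    ∑ a, h a * pderiv a k y = fderiv ℝ k y h := by
  have : h = ∑ a, h a • EuclideanSpace.single a (1 : ℝ) := by
    ext b
    simp [Pi.single_apply]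
  conv_rhs => rw [this]
  simp [pderiv]

lemma integrable_kernel_mul_orbit {Ω : Type*} {T : EuclideanSpace ℝ (Fin N) → Ω → Ω}
    {k : EuclideanSpace ℝ (Fin N) → ℝ} (hk : IsTest k) {f : Ω → ℝ} {ω : Ω}
    (hf : LocallyIntegrable fun y => f (T y ω)) :
    Integrable fun y => k y * f (T (-y) ω) := by
  have h := hk.compact.convolutionExists_left (ContinuousLinearMap.lsmul ℝ ℝ) hk.continuous hf 0
  simpa only [ConvolutionExistsAt, zero_sub, ContinuousLinearMap.lsmul_apply, smul_eq_mul] using h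

lemma orbitConv_add {Ω : Type*} {T : EuclideanSpace ℝ (Fin N) → Ω → Ω}
    {k : EuclideanSpace ℝ (Fin N) → ℝ} (hk : IsTest k) {f g : Ω → ℝ} {ω : Ω}
    (hf : LocallyIntegrable fun y => f (T y ω)) (hg : LocallyIntegrable fun y => g (T y ω)) :
    orbitConv T k (fun ω => f ω + g ω) ω = orbitConv T k f ω + orbitConv T k g ω := by
  simp only [orbitConv, mul_add]
  exact integral_add (integrable_kernel_mul_orbit hk hf) (integrable_kernel_mul_orbit hk hg)

lemma orbitConv_comp_sub (hT : IsFlow μ T) (k : EuclideanSpace ℝ (Fin N) → ℝ) (f : Ω → ℝ)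
    (h : EuclideanSpace ℝ (Fin N)) (ω : Ω) :
    orbitConv T (fun y => k (y - h)) f ω = orbitConv T k (fun ω => f (T (-h) ω)) ω := by
  simp only [orbitConv]
  rw [← integral_add_right_eq_self _ h]
  simp [← hT.add, neg_add_rev]

/-- The potential of a field orthogonal to the solenoidal fields, up to averaging along the orbits
with weights `w` at the points `z`. -/
lemma OrthSolenoidal.exists_potential [IsFiniteMeasure μ] {v : Fin N → Ω → ℝ}
    (h : OrthSolenoidal μ T v) (hT : IsFlow μ T) (hvm : ∀ i, Measurable (v i))
    (hvi : ∀ i, Integrable (v i) μ) {ρ : EuclideanSpace ℝ (Fin N) → ℝ} (hρ : IsTest ρ)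
    {ι : Type} [Fintype ι] {w : ι → ℝ} (hw : ∑ k, w k = 1) (z : ι → EuclideanSpace ℝ (Fin N)) :
    ∃ G : Fin N → EuclideanSpace ℝ (Fin N) → ℝ, (∀ a, IsTest (G a)) ∧ ∀ i, ∀ᵐ ω ∂μ,
      ∑ a, orbitConv T (pderiv i (G a)) (v a) ω =
        orbitConv T ρ (v i) ω - orbitConv T ρ (fun ω => ∑ k, w k * v i (T (z k) ω)) ω := by
  classical
  choose κ hκ hκd using fun k => hρ.exists_fderiv_eq_sub (-z k)
  set G : Fin N → EuclideanSpace ℝ (Fin N) → ℝ :=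
    fun a y => ∑ k, w k * (-z k) a * κ k y with hG
  have hGt : ∀ a, IsTest (G a) := fun a => IsTest.sum _ fun k => (hκ k).const_mul _
  set D : EuclideanSpace ℝ (Fin N) → ℝ := fun y => ∑ b, pderiv b (G b) y with hD
  have hDt : IsTest D := IsTest.sum _ fun b => (hGt b).pderiv b
  have hD_eq : ∀ y, D y = ρ y - ∑ k, w k * ρ (y - -z k) := by
    intro y
    simp only [hD, hG]
    simp only [fun b => pderiv_sum b Finset.univ
      (fun k => (hκ k).const_mul (w k * (-z k) b)) y,
      fun b k => pderiv_const_mul b (hκ k) (w k * (-z k) b) y]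
    rw [Finset.sum_comm]
    simp only [mul_assoc, ← Finset.mul_sum, sum_mul_pderiv, hκd, mul_sub, Finset.sum_sub_distrib,
      ← Finset.sum_mul, hw, one_mul]
  refine ⟨G, hGt, fun i => ?_⟩
  set K : Fin N → EuclideanSpace ℝ (Fin N) → ℝ :=
    fun a y => pderiv i (G a) y - (if a = i then 1 else 0) * D y with hK
  have hKt : ∀ a, IsTest (K a) := fun a => ((hGt a).pderiv i).sub (hDt.const_mul _)
  have hdiv : ∀ y, ∑ a, pderiv a (K a) y = 0 := by
    intro y
    have hK' : ∀ a, pderiv a (K a) y =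
        pderiv a (pderiv i (G a)) y - (if a = i then 1 else 0) * pderiv a D y := fun a => by
      rw [hK, pderiv_sub a ((hGt a).pderiv i) (hDt.const_mul _), pderiv_const_mul a hDt]
    simp only [hK', Finset.sum_sub_distrib, ite_mul, one_mul, zero_mul, Finset.sum_ite_eq',
      Finset.mem_univ, if_true]
    rw [hD, pderiv_sum i Finset.univ (fun b => (hGt b).pderiv b) y, sub_eq_zero]
    exact Finset.sum_congr rfl fun a _ => pderiv_comm _ _ (hGt a) y
  have hloc := fun a => ae_locallyIntegrable hT (hvm a) (hvi a)
  have hloc' := fun k => ae_locallyIntegrable hT ((hvm i).comp (hT.mp (z k)).measurable)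
    ((hT.mp (z k)).integrable_comp_of_integrable (hvi i))
  filter_upwards [h.ae_sum_orbitConv_eq_zero hT hvm hvi hKt hdiv, ae_all_iff.2 hloc,
    ae_all_iff.2 hloc'] with ω hω hl hl'
  have hsplit : ∀ a, orbitConv T (K a) (v a) ω = orbitConv T (pderiv i (G a)) (v a) ω -
      (if a = i then 1 else 0) * orbitConv T D (v a) ω := by
    intro a
    simp only [orbitConv, hK, sub_mul, mul_assoc]
    rw [integral_sub (integrable_kernel_mul_orbit ((hGt a).pderiv i) (hl a))
      ((integrable_kernel_mul_orbit hDt (hl a)).const_mul _), integral_const_mul]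
  simp only [hsplit, Finset.sum_sub_distrib, ite_mul, one_mul, zero_mul, Finset.sum_ite_eq',
    Finset.mem_univ, if_true, sub_eq_zero] at hω
  rw [hω]
  have hi : ∀ k, Integrable fun y => w k * (ρ (y - -z k) * v i (T (-y) ω)) := fun k =>
    (integrable_kernel_mul_orbit (hρ.comp_sub (-z k)) (hl i)).const_mul _
  have hi' : ∀ k, Integrable fun y => w k * (ρ y * v i (T (z k) (T (-y) ω))) := fun k =>
    (integrable_kernel_mul_orbit hρ (hl' k)).const_mul _
  calc orbitConv T D (v i) ω
      = ∫ y, (ρ y * v i (T (-y) ω) - ∑ k, w k * (ρ (y - -z k) * v i (T (-y) ω))) := by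
        simp only [orbitConv, hD_eq, sub_mul, Finset.sum_mul, mul_assoc]
    _ = orbitConv T ρ (v i) ω - ∑ k, w k * orbitConv T (fun y => ρ (y - -z k)) (v i) ω := by
        rw [integral_sub (integrable_kernel_mul_orbit hρ (hl i))
          (integrable_finsetSum _ fun k _ => hi k), integral_finsetSum _ fun k _ => hi k]
        simp only [integral_const_mul, orbitConv]
    _ = _ := by
        congr 1
        simp only [orbitConv_comp_sub hT, neg_neg]
        simp only [orbitConv, Finset.mul_sum]
        simp only [mul_left_comm (ρ _)]
        rw [integral_finsetSum _ fun k _ => hi' k]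
        simp only [integral_const_mul]

/-- Integration by parts along an orbit. -/
lemma orbitConv_pderiv {Ω : Type*} {T : EuclideanSpace ℝ (Fin N) → Ω → Ω}
    {k : EuclideanSpace ℝ (Fin N) → ℝ} (hk : IsTest k) {P P' : Ω → ℝ} {ω : Ω} {i : Fin N}
    (hP : ContDiff ℝ 1 fun x => P (T x ω))
    (hP' : ∀ x, fderiv ℝ (fun x => P (T x ω)) x (EuclideanSpace.single i 1) = P' (T x ω)) :
    orbitConv T (pderiv i k) P ω = orbitConv T k P' ω := by
  set F : EuclideanSpace ℝ (Fin N) → ℝ := fun y => P (T (-y) ω) with hF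
  have hFc : ContDiff ℝ 1 F := hP.comp contDiff_neg
  have hF' : ∀ y, fderiv ℝ F y (EuclideanSpace.single i 1) = -P' (T (-y) ω) := fun y => by
    rw [← hP']
    exact pderiv_comp_neg i (fun x => P (T x ω)) y
  have hF'c : Continuous fun y => fderiv ℝ F y (EuclideanSpace.single i 1) :=
    (hFc.continuous_fderiv (by simp)).clm_apply continuous_const
  have hparts := integral_mul_fderiv_eq_neg_fderiv_mul_of_integrable (μ := volume) (f := k) (g := F)
    (v := EuclideanSpace.single i 1)
    (((hk.pderiv i).continuous.mul hFc.continuous).integrable_of_hasCompactSupport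
      (hk.pderiv i).compact.mul_right)
    ((hk.continuous.mul hF'c).integrable_of_hasCompactSupport hk.compact.mul_right)
    ((hk.continuous.mul hFc.continuous).integrable_of_hasCompactSupport hk.compact.mul_right)
    (fun x _ => hk.differentiable x) (fun x _ => hFc.differentiable (by simp) x)
  simp only [hF', mul_neg, integral_neg, neg_inj] at hparts
  exact hparts.symm

end Kernels

section Jensen

variable {N : ℕ} {Ω : Type*} [MeasurableSpace Ω] {μ : Measure Ω}
  {T : EuclideanSpace ℝ (Fin N) → Ω → Ω} {Φ : ℝ → ℝ}

lemma lintegral_orbitConv_le [SFinite μ] (hT : IsFlow μ T) (hY : IsYoung Φ)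
    {ρ : EuclideanSpace ℝ (Fin N) → ℝ} (hρ : IsTest ρ) (h0 : ∀ y, 0 ≤ ρ y) (h1 : ∫ y, ρ y = 1)
    {f : Ω → ℝ} (hf : Measurable f) {δ : ℝ} (hδ : 0 < δ) :
    ∫⁻ ω, ENNReal.ofReal (Φ (|orbitConv T ρ f ω| / δ)) ∂μ ≤
      ∫⁻ ω, ENNReal.ofReal (Φ (|f ω| / δ)) ∂μ := by
  set κ : Measure (EuclideanSpace ℝ (Fin N)) :=
    volume.withDensity fun y => ENNReal.ofReal (ρ y) with hκ
  have hκ1 : IsProbabilityMeasure κ := ⟨by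
    rw [hκ, withDensity_apply _ MeasurableSet.univ, Measure.restrict_univ,
      ← ofReal_integral_eq_lintegral_ofReal hρ.integrable (.of_forall h0), h1, ENNReal.ofReal_one]⟩
  have hJ : ∀ ω, orbitConv T ρ f ω = ∫ y, f (T (-y) ω) ∂κ := fun ω => by
    rw [hκ, integral_withDensity_eq_integral_toReal_smul hρ.continuous.measurable.ennreal_ofReal
      (.of_forall fun _ => ENNReal.ofReal_lt_top)]
    simp only [orbitConv, ENNReal.toReal_ofReal (h0 _), smul_eq_mul]
  set g : Ω → ENNReal := fun ω => ENNReal.ofReal (Φ (|f ω| / δ)) with hg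
  have hgm : Measurable g := hY.measurable_ofReal hf hδ
  calc ∫⁻ ω, ENNReal.ofReal (Φ (|orbitConv T ρ f ω| / δ)) ∂μ
      ≤ ∫⁻ ω, (∫⁻ y, g (T (-y) ω) ∂κ) ∂μ := by
        refine lintegral_mono fun ω => ?_
        simp only [hJ]
        exact hY.ofReal_integral_le κ
          (hf.comp (hT.meas.comp (measurable_neg.prodMk measurable_const))) hδ
    _ = ∫⁻ y, (∫⁻ ω, g (T (-y) ω) ∂μ) ∂κ :=
        lintegral_lintegral_swap (hgm.comp (hT.measurable_neg.comp measurable_swap)).aemeasurable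
    _ = ∫⁻ ω, g ω ∂μ := by
        simp only [fun y => (hT.mp (-y)).lintegral_comp hgm, lintegral_const, measure_univ, mul_one]

lemma LuxLE.map_orbitConv [SFinite μ] (hT : IsFlow μ T) (hY : IsYoung Φ)
    {ρ : EuclideanSpace ℝ (Fin N) → ℝ} (hρ : IsTest ρ) (h0 : ∀ y, 0 ≤ ρ y) (h1 : ∫ y, ρ y = 1)
    {f : Ω → ℝ} (hf : Measurable f) {δ : ℝ} (hδ : 0 < δ) (h : LuxLE Φ μ f δ) :
    LuxLE Φ μ (orbitConv T ρ f) δ :=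
  (lintegral_orbitConv_le hT hY hρ h0 h1 hf hδ).trans h

lemma OrliczHeart.map_orbitConv [SFinite μ] (hT : IsFlow μ T) (hY : IsYoung Φ)
    {ρ : EuclideanSpace ℝ (Fin N) → ℝ} (hρ : IsTest ρ) (h0 : ∀ y, 0 ≤ ρ y) (h1 : ∫ y, ρ y = 1)
    {f : Ω → ℝ} (hf : OrliczHeart Φ μ f) : OrliczHeart Φ μ (orbitConv T ρ f) :=
  ⟨measurable_orbitConv hT hρ.continuous.measurable hf.1, fun δ hδ =>
    (lintegral_orbitConv_le hT hY hρ h0 h1 hf.1 hδ).trans_lt (hf.2 δ hδ)⟩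

end Jensen

section Approximation

variable {N : ℕ} {Ω : Type*} [MeasurableSpace Ω] {μ : Measure Ω}
  {T : EuclideanSpace ℝ (Fin N) → Ω → Ω} {Φ : ℝ → ℝ}

/-- Nonnegative smooth kernels of unit mass. -/
structure IsMollifier (ρ : EuclideanSpace ℝ (Fin N) → ℝ) : Prop extends IsTest ρ where
  nonneg : ∀ y, 0 ≤ ρ y
  integral : ∫ y, ρ y = 1

lemma exists_isMollifier_tendsto (N : ℕ) :
    ∃ ρ : ℕ → EuclideanSpace ℝ (Fin N) → ℝ, (∀ n, IsMollifier (ρ n)) ∧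
      ∀ g : EuclideanSpace ℝ (Fin N) → ℝ, LocallyIntegrable g → ∀ᵐ x, Tendsto
        (fun n => convolution (ρ n) g (ContinuousLinearMap.lsmul ℝ ℝ) volume x) atTop (𝓝 (g x)) := by
  let φ : ℕ → ContDiffBump (0 : EuclideanSpace ℝ (Fin N)) := fun n =>
    ⟨1 / ((n : ℝ) + 1), 2 * (1 / ((n : ℝ) + 1)), by positivity, by
      have : 0 < 1 / ((n : ℝ) + 1) := by positivity
      linarith⟩
  refine ⟨fun n => (φ n).normed volume, fun n => ⟨⟨(φ n).contDiff_normed,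
    (φ n).hasCompactSupport_normed⟩, (φ n).nonneg_normed, (φ n).integral_normed⟩, fun g hg => ?_⟩
  refine ContDiffBump.ae_convolution_tendsto_right_of_locallyIntegrable (K := 2) ?_
    (.of_forall fun n => le_rfl) hg
  have h := (tendsto_one_div_add_atTop_nhds_zero_nat (𝕜 := ℝ)).const_mul 2
  rw [mul_zero] at h
  exact h

lemma ae_tendsto_orbitConv [SFinite μ] (hT : IsFlow μ T)
    {ρ : ℕ → EuclideanSpace ℝ (Fin N) → ℝ} (hρ : ∀ n, IsMollifier (ρ n))
    (hlim : ∀ g : EuclideanSpace ℝ (Fin N) → ℝ, LocallyIntegrable g → ∀ᵐ x, Tendsto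
      (fun n => convolution (ρ n) g (ContinuousLinearMap.lsmul ℝ ℝ) volume x) atTop (𝓝 (g x)))
    {f : Ω → ℝ} (hfm : Measurable f) (hf : Integrable f μ) :
    ∀ᵐ ω ∂μ, Tendsto (fun n => orbitConv T (ρ n) f ω) atTop (𝓝 (f ω)) := by
  set S : Set Ω := {ω | Tendsto (fun n => orbitConv T (ρ n) f ω) atTop (𝓝 (f ω))} with hS
  have hSm : MeasurableSet S := measurableSet_tendsto_fun
    (fun n => measurable_orbitConv hT (hρ n).continuous.measurable hfm) hfm
  have h1 : ∀ᵐ ω ∂μ, ∀ᵐ x, T x ω ∈ S := by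
    filter_upwards [ae_locallyIntegrable hT hfm hf] with ω hω
    filter_upwards [hlim _ hω] with x hx
    simpa only [hS, mem_ofPred_eq, orbitConv_apply_flow hT] using hx
  have h2 : ∀ᵐ x : EuclideanSpace ℝ (Fin N), ∀ᵐ ω ∂μ, T x ω ∈ S :=
    (Measure.ae_ae_comm (μ := μ) (ν := volume) (p := fun ω x => T x ω ∈ S) (hT.meas.comp measurable_swap hSm)).1 h1
  obtain ⟨x, hx⟩ := h2.exists
  have h3 : μ (T x ⁻¹' Sᶜ) = 0 := hx
  rw [(hT.mp x).measure_preimage hSm.compl.nullMeasurableSet] at h3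
  exact h3

lemma OrliczHeart.const [IsFiniteMeasure μ] (Φ : ℝ → ℝ) (c : ℝ) :
    OrliczHeart Φ μ fun _ => c :=
  ⟨measurable_const, fun δ _ => by
    rw [lintegral_const]
    exact ENNReal.mul_lt_top ENNReal.ofReal_lt_top (measure_lt_top _ _)⟩

lemma OrliczHeart.eventually_luxLE_sub_orbitConv [IsFiniteMeasure μ] (hT : IsFlow μ T)
    (hY : IsYoung Φ) {ρ : ℕ → EuclideanSpace ℝ (Fin N) → ℝ} (hρ : ∀ n, IsMollifier (ρ n))
    (hlim : ∀ g : EuclideanSpace ℝ (Fin N) → ℝ, LocallyIntegrable g → ∀ᵐ x, Tendsto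
      (fun n => convolution (ρ n) g (ContinuousLinearMap.lsmul ℝ ℝ) volume x) atTop (𝓝 (g x)))
    {f : Ω → ℝ} (hf : OrliczHeart Φ μ f) {δ : ℝ} (hδ : 0 < δ) :
    ∀ᶠ n in atTop, LuxLE Φ μ (fun ω => f ω - orbitConv T (ρ n) f ω) δ := by
  obtain ⟨b, r, hbm, hr, ⟨C, hC⟩, hrδ, hfbr⟩ := hf.exists_bounded_add hY (by positivity : 0 < δ / 3)
  have hJm : ∀ n {g : Ω → ℝ}, Measurable g → Measurable (orbitConv T (ρ n) g) := fun n _ hg =>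
    measurable_orbitConv hT (hρ n).continuous.measurable hg
  have hbi : Integrable b μ := .of_bound hbm.aestronglyMeasurable C (.of_forall hC)
  have hev := (OrliczHeart.const (μ := μ) Φ (2 * C)).eventually_luxLE hY
    (F := fun n ω => b ω - orbitConv T (ρ n) b ω) (fun n => hbm.sub (hJm n hbm))
    (fun n => .of_forall fun ω => by
      have h1 := abs_orbitConv_le (T := T) (hρ n).integrable hC ω
      simp only [abs_of_nonneg ((hρ n).nonneg _), (hρ n).integral, one_mul] at h1
      have h2 := abs_sub (b ω) (orbitConv T (ρ n) b ω)
      have h3 := le_abs_self (2 * C)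
      linarith [hC ω])
    (by
      filter_upwards [ae_tendsto_orbitConv hT hρ hlim hbm hbi] with ω hω
      simpa using hω.const_sub (b ω)) (by positivity : 0 < δ / 3)
  filter_upwards [hev] with n hn
  have hrJ : LuxLE Φ μ (fun ω => -orbitConv T (ρ n) r ω) (δ / 3) :=
    (hrδ.map_orbitConv hT hY (hρ n).toIsTest (hρ n).nonneg (hρ n).integral hr.1 (by positivity)).neg
  have htot := (hn.add hY (hbm.sub (hJm n hbm)) hr.1 (by positivity) (by positivity) hrδ).add hY
    ((hbm.sub (hJm n hbm)).add hr.1) (hJm n hr.1).neg (by positivity) (by positivity) hrJ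
  rw [show δ / 3 + δ / 3 + δ / 3 = δ by ring] at htot
  refine htot.congr ?_
  filter_upwards [ae_locallyIntegrable hT hbm hbi,
    ae_locallyIntegrable hT hr.1 (hr.integrable hY)] with ω h1 h2
  have : orbitConv T (ρ n) f ω = orbitConv T (ρ n) b ω + orbitConv T (ρ n) r ω := by
    rw [← orbitConv_add (hρ n).toIsTest h1 h2, funext hfbr]
  simp only [Pi.add_apply, Pi.sub_apply, Pi.neg_apply, this, hfbr ω]
  ring

/-- Mean ergodic theorem in the Orlicz heart: convex averages along orbits of finitely many mean-zero
functions can be made simultaneously small. -/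
lemma IsFlow.exists_convex_average_luxLE [IsProbabilityMeasure μ] (hT : IsFlow μ T)
    (hY : IsYoung Φ)
    (herg : ∀ h : Ω → ℝ, Measurable h → (∀ x, ∀ᵐ ω ∂μ, h (T x ω) = h ω) →
      ∃ c : ℝ, ∀ᵐ ω ∂μ, h ω = c)
    {v : Fin N → Ω → ℝ} (hv : ∀ i, OrliczHeart Φ μ (v i)) (h0 : ∀ i, ∫ ω, v i ω ∂μ = 0)
    {δ : ℝ} (hδ : 0 < δ) :
    ∃ (ι : Type) (_ : Fintype ι) (w : ι → ℝ) (z : ι → EuclideanSpace ℝ (Fin N)),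
      (∀ k, 0 ≤ w k) ∧ ∑ k, w k = 1 ∧
      ∀ i, LuxLE Φ μ (fun ω => ∑ k, w k * v i (T (z k) ω)) δ := by
  have hδ3 : 0 < δ / 3 := by positivity
  choose b r hbm hr hC hrδ hvbr using fun i => (hv i).exists_bounded_add hY hδ3
  choose C hC using hC
  have hbi : ∀ i, Integrable (b i) μ := fun i =>
    .of_bound (hbm i).aestronglyMeasurable (C i) (.of_forall (hC i))
  set m : Fin N → ℝ := fun i => ∫ ω, b i ω ∂μ with hm
  have hm' : ∀ i, m i = -∫ ω, r i ω ∂μ := fun i => by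
    have := h0 i
    simp only [hvbr] at this
    rw [integral_add (hbi i) ((hr i).integrable hY)] at this
    simp only [hm]
    linarith
  set K : ℝ := 1 + ∑ i, (|C i| + |m i|) with hK
  have hKpos : 0 < K := by positivity
  have hfm : ∀ i, Measurable fun ω => b i ω - m i := fun i => (hbm i).sub_const _
  have hbK : ∀ i ω, |b i ω - m i| ≤ K := fun i ω => by
    have h1 := abs_sub (b i ω) (m i)
    have h2 := Finset.single_le_sum (f := fun i => |C i| + |m i|) (fun j _ => by positivity)
      (Finset.mem_univ i)
    have h3 := le_abs_self (C i)
    beta_reduce at h2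
    linarith [hC i ω]
  set c : ℝ := Φ (K / (δ / 3)) / K with hc
  have hcpos : 0 < c := div_pos (hY.pos _ (by positivity)) hKpos
  obtain ⟨ι, hι, w, z, hw, hw1, hsmall⟩ := hT.exists_convex_average_lt herg
    (fun i ω => b i ω - m i) hfm (fun i => ⟨K, hbK i⟩)
    (fun i => by rw [integral_sub (hbi i) (integrable_const _)]; simp [hm])
    (by positivity : 0 < 1 / c)
  refine ⟨ι, hι, w, z, hw, hw1, fun i => ?_⟩
  have hAm : ∀ {g : Ω → ℝ}, Measurable g → Measurable fun ω => ∑ k, w k * g (T (z k) ω) :=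
    fun hg => Finset.measurable_fun_sum _ fun k _ => (hg.comp (hT.mp (z k)).measurable).const_mul _
  have hAb : ∀ ω, |∑ k, w k * (b i (T (z k) ω) - m i)| ≤ K := fun ω => by
    refine (Finset.abs_sum_le_sum_abs _ _).trans ?_
    calc ∑ k, |w k * (b i (T (z k) ω) - m i)| ≤ ∑ k, w k * K := by
          refine Finset.sum_le_sum fun k _ => ?_
          rw [abs_mul, abs_of_nonneg (hw k)]
          exact mul_le_mul_of_nonneg_left (hbK i _) (hw k)
      _ = K := by rw [← Finset.sum_mul, hw1, one_mul]
  have h1 : LuxLE Φ μ (fun ω => ∑ k, w k * (b i (T (z k) ω) - m i)) (δ / 3) := by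
    refine LuxLE.of_bounded hY (.of_bound (hAm (hfm i)).aestronglyMeasurable K (.of_forall hAb))
      hKpos hδ3 (.of_forall hAb) ?_
    have := mul_le_mul_of_nonneg_right (hsmall i).le hcpos.le
    rwa [one_div_mul_cancel hcpos.ne'] at this
  have h2 : LuxLE Φ μ (fun _ => m i) (δ / 3) := by
    simpa only [hm'] using (LuxLE.integral_const hY (hr i).1 hδ3 (hrδ i)).neg
  have h3 : LuxLE Φ μ (fun ω => ∑ k, w k * r i (T (z k) ω)) (δ / 3) :=
    LuxLE.sum_smul hY hw hw1 (fun k => (hr i).1.comp (hT.mp (z k)).measurable) hδ3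
      fun k => (hrδ i).comp hY (hr i).1 hδ3 (hT.mp (z k))
  have htot := (h1.add hY (hAm (hfm i)) measurable_const hδ3 hδ3 h2).add hY
    ((hAm (hfm i)).add_const _) (hAm (hr i).1) (by positivity) hδ3 h3
  rw [show δ / 3 + δ / 3 + δ / 3 = δ by ring] at htot
  refine htot.congr (.of_forall fun ω => ?_)
  simp only [hvbr, mul_add, mul_sub, Finset.sum_add_distrib, Finset.sum_sub_distrib,
    ← Finset.sum_mul, hw1]
  ring

end Approximation

section Truncation

/-- A smooth bounded truncation of the identity at height of order `n`. -/
noncomputable def softTrunc (n : ℕ) (t : ℝ) : ℝ := ((n : ℝ) + 1) * Real.arctan (t / ((n : ℝ) + 1))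

/-- The derivative of `softTrunc`. -/
noncomputable def softTruncDeriv (n : ℕ) (t : ℝ) : ℝ := 1 / (1 + (t / ((n : ℝ) + 1)) ^ 2)

lemma hasDerivAt_softTrunc (n : ℕ) (t : ℝ) : HasDerivAt (softTrunc n) (softTruncDeriv n t) t := by
  have hn : (n : ℝ) + 1 ≠ 0 := by positivity
  have h := (((hasDerivAt_id t).div_const ((n : ℝ) + 1)).arctan).const_mul ((n : ℝ) + 1)
  refine h.congr_deriv ?_
  simp only [softTruncDeriv, id]
  field_simp

lemma contDiff_softTrunc (n : ℕ) : ContDiff ℝ 1 (softTrunc n) :=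
  contDiff_const.mul (ContDiff.arctan (n := 1) (contDiff_id.div_const ((n : ℝ) + 1)))

lemma abs_softTrunc_le (n : ℕ) (t : ℝ) : |softTrunc n t| ≤ ((n : ℝ) + 1) * (Real.pi / 2) := by
  rw [softTrunc, abs_mul, abs_of_pos (by positivity : (0 : ℝ) < n + 1)]
  gcongr
  exact abs_le.2 ⟨(Real.neg_pi_div_two_lt_arctan _).le, (Real.arctan_lt_pi_div_two _).le⟩

lemma continuous_softTruncDeriv (n : ℕ) : Continuous (softTruncDeriv n) :=
  continuous_const.div (by fun_prop) fun t => by positivity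

lemma abs_one_sub_softTruncDeriv_le (n : ℕ) (t : ℝ) : |1 - softTruncDeriv n t| ≤ 1 := by
  have h0 : 0 ≤ softTruncDeriv n t := by unfold softTruncDeriv; positivity
  have h1 : softTruncDeriv n t ≤ 1 := by
    rw [softTruncDeriv, div_le_one (by positivity)]
    linarith [sq_nonneg (t / ((n : ℝ) + 1))]
  rw [abs_le]
  constructor <;> linarith

lemma tendsto_softTruncDeriv (t : ℝ) :
    Tendsto (fun n => softTruncDeriv n t) atTop (𝓝 1) := by
  have h : Tendsto (fun n : ℕ => t / ((n : ℝ) + 1)) atTop (𝓝 0) := by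
    have h := (tendsto_one_div_add_atTop_nhds_zero_nat (𝕜 := ℝ)).const_mul t
    simpa only [mul_zero, mul_one_div] using h
  have hc : ContinuousAt (fun s : ℝ => 1 / (1 + s ^ 2)) 0 := by
    refine ContinuousAt.div (by fun_prop) (by fun_prop) (by norm_num)
  simpa [softTruncDeriv, Function.comp_def] using hc.tendsto.comp h

variable {N : ℕ} {Ω : Type*} [MeasurableSpace Ω] {μ : Measure Ω}
  {T : EuclideanSpace ℝ (Fin N) → Ω → Ω} {Φ : ℝ → ℝ}

/-- Chain rule and integration by parts for a truncated potential. -/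
lemma orbitConv_pderiv_softTrunc (hT : IsFlow μ T) {ρ : EuclideanSpace ℝ (Fin N) → ℝ}
    (hρ : IsTest ρ) {G : Fin N → EuclideanSpace ℝ (Fin N) → ℝ} (hG : ∀ a, IsTest (G a))
    {v : Fin N → Ω → ℝ} {ω : Ω} (hv : ∀ a, LocallyIntegrable fun y => v a (T y ω)) (n : ℕ)
    (i : Fin N) :
    orbitConv T (pderiv i ρ) (fun ω => softTrunc n (∑ a, orbitConv T (G a) (v a) ω)) ω =
      orbitConv T ρ (fun ω => softTruncDeriv n (∑ a, orbitConv T (G a) (v a) ω) *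
        ∑ a, orbitConv T (pderiv i (G a)) (v a) ω) ω := by
  refine orbitConv_pderiv hρ ((contDiff_softTrunc n).comp (ContDiff.sum fun a _ =>
    (contDiff_orbitConv hT (hG a) (hv a)).of_le (by simp))) fun x => ?_
  choose D hD hDv using fun a => hasFDerivAt_orbitConv hT (hG a) (hv a) x
  have h : HasFDerivAt (fun x => softTrunc n (∑ a, orbitConv T (G a) (v a) (T x ω)))
      (softTruncDeriv n (∑ a, orbitConv T (G a) (v a) (T x ω)) • ∑ a, D a) x :=
    (hasDerivAt_softTrunc n _).comp_hasFDerivAt x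
      (HasFDerivAt.fun_sum (u := Finset.univ) fun a _ => hD a)
  rw [h.fderiv]
  simp only [smul_apply, sum_apply, hDv, smul_eq_mul]
  rfl

lemma OrliczHeart.eventually_luxLE_one_sub_softTruncDeriv_mul (hY : IsYoung Φ) {ψ q : Ω → ℝ}
    (hψ : Measurable ψ) (hq : OrliczHeart Φ μ q) {δ : ℝ} (hδ : 0 < δ) :
    ∀ᶠ n in atTop, LuxLE Φ μ (fun ω => (1 - softTruncDeriv n (ψ ω)) * q ω) δ := by
  refine hq.eventually_luxLE hY
    (fun n => (measurable_const.sub ((continuous_softTruncDeriv n).measurable.comp hψ)).mul hq.1)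
    (fun n => .of_forall fun ω => ?_) (.of_forall fun ω => ?_) hδ
  · simp only [Pi.mul_apply, Pi.sub_apply, Function.comp_apply, abs_mul]
    exact mul_le_of_le_one_left (abs_nonneg _) (abs_one_sub_softTruncDeriv_le n _)
  · simpa using ((tendsto_softTruncDeriv (ψ ω)).const_sub 1).mul_const (q ω)

/-- A field in the Orlicz heart orthogonal to the smooth solenoidal fields is approximated by
stochastic gradients of smooth functions. -/
lemma OrthSolenoidal.exists_gradient_luxLE [IsProbabilityMeasure μ] {v : Fin N → Ω → ℝ}
    (h : OrthSolenoidal μ T v) (hT : IsFlow μ T) (hY : IsYoung Φ)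
    (herg : ∀ h : Ω → ℝ, Measurable h → (∀ x, ∀ᵐ ω ∂μ, h (T x ω) = h ω) →
      ∃ c : ℝ, ∀ᵐ ω ∂μ, h ω = c)
    (hv : ∀ i, OrliczHeart Φ μ (v i)) {δ : ℝ} (hδ : 0 < δ) :
    ∃ Dψ : List (Fin N) → Ω → ℝ, StochSmoothFamily μ T Dψ ∧
      ∀ i, LuxLE Φ μ (fun ω => v i ω - Dψ [i] ω) (4 * δ) := by
  obtain ⟨ι, _, w, z, -, hw1, hA⟩ :=
    hT.exists_convex_average_luxLE hY herg hv h.integral_eq_zero hδ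
  obtain ⟨ρ', hρ', hlim⟩ := exists_isMollifier_tendsto N
  obtain ⟨n, hn⟩ := (eventually_all.2 fun i =>
    (hv i).eventually_luxLE_sub_orbitConv hT hY hρ' hlim hδ).exists
  have hρ := hρ' n
  set ρ := ρ' n
  have hvi : ∀ i, Integrable (v i) μ := fun i => (hv i).integrable hY
  obtain ⟨G, hG, hq⟩ := h.exists_potential hT (fun i => (hv i).1) hvi hρ.toIsTest hw1 z
  set A : Fin N → Ω → ℝ := fun i ω => ∑ k, w k * v i (T (z k) ω) with hAdef
  have hAh : ∀ i, OrliczHeart Φ μ (A i) := fun i =>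
    OrliczHeart.finsetSum hY _ fun k => ((hv i).comp hY (hT.mp (z k))).const_mul hY _
  have hJh : ∀ {f : Ω → ℝ}, OrliczHeart Φ μ f → OrliczHeart Φ μ (orbitConv T ρ f) := fun hf =>
    OrliczHeart.map_orbitConv hT hY hρ.toIsTest hρ.nonneg hρ.integral hf
  set ψ : Ω → ℝ := fun ω => ∑ a, orbitConv T (G a) (v a) ω with hψ
  have hψm : Measurable ψ := Finset.measurable_fun_sum _ fun a _ =>
    measurable_orbitConv hT (hG a).continuous.measurable (hv a).1
  set q : Fin N → Ω → ℝ := fun i ω => ∑ a, orbitConv T (pderiv i (G a)) (v a) ω with hqdef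
  have hqm : ∀ i, Measurable (q i) := fun i => Finset.measurable_fun_sum _ fun a _ =>
    measurable_orbitConv hT ((hG a).pderiv i).continuous.measurable (hv a).1
  have hqh : ∀ i, OrliczHeart Φ μ (q i) := fun i => by
    refine ((hJh (hv i)).add hY ((hJh (hAh i)).const_mul hY (-1))).congr (hqm i) ?_
    filter_upwards [hq i] with ω hω
    simp only [hqdef, hω]
    ring
  obtain ⟨m, hm⟩ := (eventually_all.2 fun i =>
    (hqh i).eventually_luxLE_one_sub_softTruncDeriv_mul hY hψm hδ).exists
  have hηm : Measurable fun ω => softTrunc m (ψ ω) :=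
    (contDiff_softTrunc m).continuous.measurable.comp hψm
  have hdm : Measurable fun ω => softTruncDeriv m (ψ ω) :=
    (continuous_softTruncDeriv m).measurable.comp hψm
  refine ⟨_, stochSmoothFamily_orbitConv hT hρ.toIsTest hηm fun ω => abs_softTrunc_le m (ψ ω),
    fun i => ?_⟩
  have hvq : LuxLE Φ μ (fun ω => v i ω - q i ω) (δ + δ) := by
    refine ((hn i).add hY ((hv i).1.sub (hJh (hv i)).1) (hJh (hAh i)).1 hδ hδ
      (LuxLE.map_orbitConv hT hY hρ.toIsTest hρ.nonneg hρ.integral (hAh i).1 hδ (hA i))).congr ?_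
    filter_upwards [hq i] with ω hω
    simp only [hqdef, hω, Pi.sub_apply]
    ring
  have hvqm : Measurable fun ω => v i ω - q i ω := (hv i).1.sub (hqm i)
  have hrm : Measurable fun ω => (1 - softTruncDeriv m (ψ ω)) * q i ω :=
    (measurable_const.sub hdm).mul (hqm i)
  have hJm : ∀ {f : Ω → ℝ}, Measurable f → Measurable (orbitConv T ρ f) := fun hf =>
    measurable_orbitConv hT hρ.continuous.measurable hf
  have htot := ((hn i).add hY ((hv i).1.sub (hJm (hv i).1)) (hJm hvqm) hδ (by positivity)
    (LuxLE.map_orbitConv hT hY hρ.toIsTest hρ.nonneg hρ.integral hvqm (by positivity) hvq)).add hY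
    (((hv i).1.sub (hJm (hv i).1)).add (hJm hvqm)) (hJm hrm) (by positivity) hδ
    (LuxLE.map_orbitConv hT hY hρ.toIsTest hρ.nonneg hρ.integral hrm hδ (hm i))
  rw [show δ + (δ + δ) + δ = 4 * δ by ring] at htot
  refine htot.congr ?_
  have hqi : Integrable (q i) μ := (hqh i).integrable hY
  have hri : Integrable (fun ω => (1 - softTruncDeriv m (ψ ω)) * q i ω) μ :=
    hqi.bdd_mul (c := 1) (measurable_const.sub hdm).aestronglyMeasurable
      (.of_forall fun ω => abs_one_sub_softTruncDeriv_le m _)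
  have hdi : Integrable (fun ω => softTruncDeriv m (ψ ω) * q i ω) μ := by
    refine (hqi.sub hri).congr (.of_forall fun ω => ?_)
    simp only [Pi.sub_apply]
    ring
  filter_upwards [ae_all_iff.2 fun a => ae_locallyIntegrable hT (hv a).1 (hvi a),
    ae_locallyIntegrable hT (f := fun ω => v i ω - q i ω) hvqm ((hvi i).sub hqi),
    ae_locallyIntegrable hT hrm hri,
    ae_locallyIntegrable hT (f := fun ω => softTruncDeriv m (ψ ω) * q i ω) (hdm.mul (hqm i)) hdi]
    with ω hlv hlvq hlr hld
  have hsplit : orbitConv T ρ (v i) ω = orbitConv T ρ (fun ω => v i ω - q i ω) ω +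
      (orbitConv T ρ (fun ω => (1 - softTruncDeriv m (ψ ω)) * q i ω) ω +
        orbitConv T ρ (fun ω => softTruncDeriv m (ψ ω) * q i ω) ω) := by
    rw [← orbitConv_add (f := fun ω => (1 - softTruncDeriv m (ψ ω)) * q i ω)
        (g := fun ω => softTruncDeriv m (ψ ω) * q i ω) hρ.toIsTest hlr hld,
      ← orbitConv_add (f := fun ω => v i ω - q i ω) hρ.toIsTest hlvq (hlr.add hld)]
    congr 1
    funext ω
    ring
  have hgrad := orbitConv_pderiv_softTrunc hT hρ.toIsTest hG hlv m i
  simp only [Pi.add_apply, Pi.sub_apply, hsplit, iterPderiv]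
  rw [hgrad]
  ring

end Truncation

theorem stmt15 {N : ℕ} {Ω : Type*} [MeasurableSpace Ω]
    (Φ : ℝ → ℝ) (hY : IsYoung Φ) (hΔ : Delta2 Φ) (hΔconj : Delta2 (youngConj Φ))
    (μ : Measure Ω) [IsProbabilityMeasure μ]
    (T : EuclideanSpace ℝ (Fin N) → Ω → Ω)
    (hT0 : T 0 = id) (hTgrp : ∀ x y, T (x + y) = T x ∘ T y)
    (hTmp : ∀ x, MeasurePreserving (T x) μ μ)
    (hTjm : Measurable fun p : EuclideanSpace ℝ (Fin N) × Ω => T p.1 p.2)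
    (herg : ∀ h : Ω → ℝ, Measurable h → (∀ x, ∀ᵐ ω ∂μ, h (T x ω) = h ω) →
      ∃ c : ℝ, ∀ᵐ ω ∂μ, h ω = c)
    (v : Fin N → Ω → ℝ) (hv : ∀ i, MemLPhi Φ μ (v i))
    (horth : ∀ Dg : Fin N → List (Fin N) → Ω → ℝ,
      (∀ i, StochSmoothFamily μ T (Dg i)) →
      (∀ᵐ ω ∂μ, ∑ i, Dg i [i] ω = 0) →
      ∫ ω, ∑ i, v i ω * Dg i [] ω ∂μ = 0) :
    ∀ ε > (0:ℝ), ∃ Dψ : List (Fin N) → Ω → ℝ, StochSmoothFamily μ T Dψ ∧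
      ∑ i, luxNorm Φ μ (fun ω => v i ω - Dψ [i] ω) < ε := by
  have hT : IsFlow μ T := ⟨fun ω => by rw [hT0]; rfl, fun x y ω => by rw [hTgrp]; rfl, hTmp, hTjm⟩
  have hvh : ∀ i, OrliczHeart Φ μ (v i) := fun i => (hv i).orliczHeart hY hΔ
  have h : OrthSolenoidal μ T v := horth
  intro ε hε
  set δ : ℝ := ε / (4 * ((N : ℝ) + 1)) with hδ
  have hδpos : 0 < δ := by positivity
  obtain ⟨Dψ, hDψ, hle⟩ := h.exists_gradient_luxLE hT hY herg hvh hδpos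
  refine ⟨Dψ, hDψ, ?_⟩
  calc ∑ i, luxNorm Φ μ (fun ω => v i ω - Dψ [i] ω) ≤ ∑ _i : Fin N, 4 * δ :=
        Finset.sum_le_sum fun i _ => (hle i).luxNorm_le (by positivity)
    _ = (N : ℝ) * (4 * δ) := by simp
    _ < ((N : ℝ) + 1) * (4 * δ) := by
        have : 0 < 4 * δ := by positivity
        nlinarith
    _ = ε := by
        rw [hδ]
        field_simp
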